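/- arXiv:1708.07331 — 3 statements merged into one kernel-verified Lean document; each statement's English description precedes it below -/
import Mathlib

section
/- Let p and q be distinct odd primes. Let G be a finite group containing an element whose order is divisible by p·q. Assume that no composition factor of G belongs to 𝒮_{p,q}; that is, for every subnormal subgroup H of G and every normal subgroup N of H such that H/N is a nonabelian simple group, the simple group S = H/N admits no (p,q)-Frattini triple (S, P, Q). Then there exists an element γ ∈ G \ Frat(G) whose order is divisible by p·q and by no prime other than p and q (i.e., Ω**_{p,q}(G) ≠ ∅). -/
/-- A `(p,q)`-Frattini triple on a finite group `S`: a faithful irreducible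
`𝔽_p`-module `P` and a faithful irreducible `𝔽_q`-module `Q` for `S`, both finite
(hence of `p`-power resp. `q`-power order), such that
(1) no element of `S` has order divisible by `p·q`;
(2) `H²(S, P) ≠ 0`;  (3) `H²(S, Q) ≠ 0`;
(4) `C_P(s) = 0` for every nontrivial `s ∈ S` of `q`-power order;
(5) `C_Q(s) = 0` for every nontrivial `s ∈ S` of `p`-power order. -/
structure FrattiniTriple (p q : ℕ) (S : Type) [Group S] where
  P : Type
  [addP : AddCommGroup P]
  [modP : Module (ZMod p) P]
  [finP : Finite P]
  [nontrivP : Nontrivial P]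
  ρP : Representation (ZMod p) S P
  Q : Type
  [addQ : AddCommGroup Q]
  [modQ : Module (ZMod q) Q]
  [finQ : Finite Q]
  [nontrivQ : Nontrivial Q]
  ρQ : Representation (ZMod q) S Q
  faithfulP : ∀ s : S, (∀ v : P, ρP s v = v) → s = 1
  faithfulQ : ∀ s : S, (∀ v : Q, ρQ s v = v) → s = 1
  irredP : ∀ W : Submodule (ZMod p) P, (∀ (s : S), ∀ v ∈ W, ρP s v ∈ W) → W = ⊥ ∨ W = ⊤
  irredQ : ∀ W : Submodule (ZMod q) Q, (∀ (s : S), ∀ v ∈ W, ρQ s v ∈ W) → W = ⊥ ∨ W = ⊤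
  no_pq : ∀ s : S, ¬ p * q ∣ orderOf s
  h2P : Nontrivial (groupCohomology.H2 (Rep.of ρP))
  h2Q : Nontrivial (groupCohomology.H2 (Rep.of ρQ))
  fixP : ∀ s : S, s ≠ 1 → (∃ b : ℕ, orderOf s = q ^ b) → ∀ v : P, ρP s v = v → v = 0
  fixQ : ∀ s : S, s ≠ 1 → (∃ a : ℕ, orderOf s = p ^ a) → ∀ v : Q, ρQ s v = v → v = 0

/-- `S` admits a `(p,q)`-Frattini triple, i.e. `S ∈ 𝒮_{p,q}`. -/
def AdmitsFrattiniTriple (p q : ℕ) (S : Type) [Group S] : Prop :=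
  Nonempty (FrattiniTriple p q S)

/-- `H` is a subnormal subgroup of `G`: there is a chain `H = c 0 ⊴ c 1 ⊴ ⋯ ⊴ c n = G`. -/
def IsSubnormal {G : Type*} [Group G] (H : Subgroup G) : Prop :=
  ∃ (n : ℕ) (c : ℕ → Subgroup G), c 0 = H ∧ c n = ⊤ ∧
    ∀ i < n, c i ≤ c (i + 1) ∧ ((c i).subgroupOf (c (i + 1))).Normal

/-- A group extension of `S` by a representation `P` that has no homomorphic section
has a nonzero class in `H²(S, P)`. -/
theorem nontrivial_H2_of_no_section {k S P E : Type} [CommRing k] [Group S] [Group E]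
    [AddCommGroup P] [Module k P] (ρ : Representation k S P) (π : E →* S)
    (hπ : Function.Surjective π) (ι : Multiplicative P →* E) (hι : Function.Injective ι)
    (hker : ι.range = π.ker)
    (hconj : ∀ (e : E) (v : P),
      e * ι (Multiplicative.ofAdd v) * e⁻¹ = ι (Multiplicative.ofAdd (ρ (π e) v)))
    (hns : ¬ ∃ s : S →* E, ∀ x, π (s x) = x) :
    Nontrivial (groupCohomology.H2 (Rep.of ρ)) := by
  obtain ⟨σ, hσ⟩ := hπ.hasRightInverse
  have hex : ∀ x : S × S, ∃ v : P,
      ι (Multiplicative.ofAdd v) = σ x.1 * σ x.2 * (σ (x.1 * x.2))⁻¹ := by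
    intro x
    have : σ x.1 * σ x.2 * (σ (x.1 * x.2))⁻¹ ∈ ι.range := by
      rw [hker, MonoidHom.mem_ker]
      simp [hσ _]
    obtain ⟨v, hv⟩ := this
    exact ⟨v.toAdd, hv⟩
  choose f hf using hex
  have hf' : ∀ g h, σ g * σ h = ι (Multiplicative.ofAdd (f (g, h))) * σ (g * h) := by
    intro g h
    rw [hf]; group
  have hσc : ∀ g v, σ g * ι (Multiplicative.ofAdd v) =
      ι (Multiplicative.ofAdd (ρ g v)) * σ g := by
    intro g v
    have := hconj (σ g) v
    rw [hσ] at this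
    rw [← this]; group
  have hcoc : f ∈ groupCohomology.cocycles₂ (Rep.of ρ) := by
    rw [groupCohomology.mem_cocycles₂_iff]
    intro g h j
    apply Multiplicative.ofAdd.injective
    apply hι
    apply mul_right_cancel (b := σ (g * h * j))
    change ι (Multiplicative.ofAdd (f (g * h, j)) * Multiplicative.ofAdd (f (g, h))) * _ =
      ι (Multiplicative.ofAdd (ρ g (f (h, j))) * Multiplicative.ofAdd (f (g, h * j))) * _
    rw [mul_comm, map_mul, map_mul, mul_assoc, ← hf', ← mul_assoc, ← hf', mul_assoc (ι _),
      mul_assoc g, ← hf', ← mul_assoc, ← hσc, mul_assoc, mul_assoc, hf' h j]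
  by_contra hnt
  rw [not_nontrivial_iff_subsingleton] at hnt
  have h0 : groupCohomology.H2π (Rep.of ρ) ⟨f, hcoc⟩ = 0 := Subsingleton.elim _ _
  rw [groupCohomology.H2π_eq_zero_iff] at h0
  obtain ⟨x, hx⟩ := h0
  have hx' : ∀ g h, ρ g (x h) - x (g * h) + x g = f (g, h) := fun g h => congrFun hx (g, h)
  apply hns
  refine ⟨MonoidHom.mk' (fun g => ι (Multiplicative.ofAdd (- (x g : P))) * σ g) ?_, ?_⟩
  · intro g h
    have e : (-(x (g * h)) : P) = -(x g) + (-(ρ g (x h)) + f (g, h)) := by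
      rw [← hx']; abel
    calc _ = ι (Multiplicative.ofAdd (-(x g) + (-(ρ g (x h)) + f (g, h)))) * σ (g * h) := by
            rw [← e]
      _ = _ := by
        rw [ofAdd_add, ofAdd_add, map_mul, map_mul, mul_assoc, mul_assoc, ← hf', ← map_neg]
        rw [← mul_assoc (ι _) (σ g), ← hσc]
        group
  · intro g
    have : ι (Multiplicative.ofAdd (- (x g : P))) ∈ π.ker := by
      rw [← hker]; exact ⟨_, rfl⟩
    rw [MonoidHom.mem_ker] at this
    rw [MonoidHom.mk'_apply, map_mul, this, hσ, one_mul]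

/-- The finite irreducible faithful `𝔽_p`-modules for `S` with nonzero second cohomology on which
nontrivial `q`-elements act without fixed points: one half of a `(p,q)`-Frattini triple. -/
def HasFrattiniModule (p q : ℕ) (S : Type) [Group S] : Prop :=
  ∃ (P : Type) (_ : AddCommGroup P) (_ : Module (ZMod p) P) (ρ : Representation (ZMod p) S P),
    Finite P ∧ Nontrivial P ∧ (∀ s : S, (∀ v : P, ρ s v = v) → s = 1) ∧
    (∀ W : Submodule (ZMod p) P, (∀ (s : S), ∀ v ∈ W, ρ s v ∈ W) → W = ⊥ ∨ W = ⊤) ∧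
    Nontrivial (groupCohomology.H2 (Rep.of ρ)) ∧
    ∀ s : S, s ≠ 1 → (∃ b : ℕ, orderOf s = q ^ b) → ∀ v : P, ρ s v = v → v = 0

theorem admitsFrattiniTriple_of_hasFrattiniModule {p q : ℕ} {S : Type} [Group S]
    (hP : HasFrattiniModule p q S) (hQ : HasFrattiniModule q p S)
    (hS : ∀ s : S, ¬ p * q ∣ orderOf s) : AdmitsFrattiniTriple p q S := by
  obtain ⟨P, _, _, ρP, _, _, h1, h2, h3, h4⟩ := hP
  obtain ⟨Q, _, _, ρQ, _, _, k1, k2, k3, k4⟩ := hQ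
  exact ⟨{ P := P, ρP := ρP, Q := Q, ρQ := ρQ, faithfulP := h1, faithfulQ := k1, irredP := h2,
           irredQ := k2, no_pq := hS, h2P := h3, h2Q := k3, fixP := h4, fixQ := k4 }⟩

/-- The quotient by an abelian kernel acts on the kernel by conjugation. -/
theorem exists_conj_action {E S : Type*} [Group E] [Group S] (π : E →* S)
    (hπ : Function.Surjective π) (hcomm : ∀ v ∈ π.ker, ∀ w ∈ π.ker, v * w = w * v) :
    ∃ c : S →* MulAut π.ker, ∀ (e : E) (v : π.ker), (c (π e) v : E) = e * v * e⁻¹ := by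
  have hk : π.ker ≤ (MulAut.conjNormal : E →* MulAut π.ker).ker := by
    intro v hv
    rw [MonoidHom.mem_ker]
    ext w
    rw [MulAut.conjNormal_apply, hcomm v hv w w.2]
    simp
  refine ⟨π.liftOfSurjective hπ ⟨MulAut.conjNormal, hk⟩, fun e v => ?_⟩
  have := MonoidHom.liftOfRightInverse_comp_apply π _ (Function.rightInverse_surjInv hπ)
    ⟨(MulAut.conjNormal : E →* MulAut π.ker), hk⟩ e
  rw [← MulAut.conjNormal_apply]
  exact congrArg (fun x : MulAut π.ker => ((x v : π.ker) : E)) this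

/-- An action on an `𝔽_p`-vector space, written multiplicatively, as a representation. -/
def representationOfMulAut {p : ℕ} {S V : Type*} [Group S] [CommGroup V]
    [Module (ZMod p) (Additive V)] (c : S →* MulAut V) :
    Representation (ZMod p) S (Additive V) where
  toFun s := AddMonoidHom.toZModLinearMap p (MonoidHom.toAdditive (c s).toMonoidHom)
  map_one' := by ext x; simp
  map_mul' s t := by ext x; simp

/-- A nonsplit extension of a simple group by a minimal normal elementary abelian `p`-subgroup
with the fixed-point condition provides one half of a Frattini triple. -/
theorem hasFrattiniModule_of_extension {p q : ℕ} (hq : q.Prime)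
    {S K V : Type} [Group S] [Group K] [CommGroup V] [Module (ZMod p) (Additive V)]
    [Finite S] [Finite V] [Nontrivial V] [IsSimpleGroup S] (π : K →* S) (ι : V →* K)
    (hι : Function.Injective ι) (hker : ι.range = π.ker)
    (hπ : Function.Surjective π) (hqS : q ∣ Nat.card S)
    (c : S →* MulAut V) (hc : ∀ e v, ι (c (π e) v) = e * ι v * e⁻¹)
    (hmin : ∀ U : Subgroup K, U.Normal → U ≤ π.ker → U = ⊥ ∨ U = π.ker)
    (hns : ¬ ∃ s : S →* K, ∀ x, π (s x) = x)
    (hfix : ∀ y : K, π y ≠ 1 → (∃ b : ℕ, orderOf (π y) = q ^ b) →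
      ∀ v ∈ π.ker, y * v = v * y → v = 1) :
    HasFrattiniModule p q S := by
  let ρ : Representation (ZMod p) S (Additive V) := representationOfMulAut c
  have hρ : ∀ s (v : V), ρ s (Additive.ofMul v) = Additive.ofMul (c s v) := fun s v => rfl
  have hιk : ∀ v, ι v ∈ π.ker := fun v => hker ▸ ⟨v, rfl⟩
  have hfixρ : ∀ s : S, s ≠ 1 → (∃ b : ℕ, orderOf s = q ^ b) →
      ∀ v : Additive V, ρ s v = v → v = 0 := by
    intro s hs hb v hv
    obtain ⟨y, rfl⟩ := hπ s
    have h1 : ι (c (π y) v.toMul) = ι v.toMul := congrArg (fun x : Additive V => ι x.toMul) hv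
    rw [hc, mul_inv_eq_iff_eq_mul] at h1
    exact hι ((hfix y hs hb _ (hιk v.toMul) h1).trans ι.map_one.symm)
  refine ⟨Additive V, inferInstance, inferInstance, ρ, inferInstance, inferInstance,
    ?_, ?_, ?_, hfixρ⟩
  · have hkc : c.ker = ⊥ := by
      refine (IsSimpleGroup.eq_bot_or_eq_top_of_normal c.ker inferInstance).resolve_right ?_
      intro htop
      have : Fact q.Prime := ⟨hq⟩
      obtain ⟨s, hs⟩ := exists_prime_orderOf_dvd_card' q hqS
      obtain ⟨v, hv⟩ := exists_ne (1 : V)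
      refine hv (hfixρ s ?_ ⟨1, by simpa using hs⟩ (Additive.ofMul v) ?_)
      · rintro rfl
        rw [orderOf_one] at hs
        exact hq.one_lt.ne hs
      · have : s ∈ c.ker := htop ▸ Subgroup.mem_top s
        rw [MonoidHom.mem_ker] at this
        rw [hρ, this]; rfl
    intro s hs
    rw [← Subgroup.mem_bot, ← hkc, MonoidHom.mem_ker]
    ext v
    exact congrArg Additive.toMul (hs (Additive.ofMul v))
  · intro W hW
    let U : Subgroup K := (AddSubgroup.toSubgroup' W.toAddSubgroup).map ι
    have hU : ∀ v : V, ι v ∈ U ↔ Additive.ofMul v ∈ W := by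
      intro v
      constructor
      · rintro ⟨w, hw, hwv⟩
        have : w = v := hι hwv
        exact this ▸ hw
      · intro h
        exact ⟨v, h, rfl⟩
    have hUle : U ≤ π.ker := by
      rw [← hker]
      exact Subgroup.map_le_range _ _
    have hUn : U.Normal := by
      refine ⟨?_⟩
      rintro _ ⟨w, hw, rfl⟩ g
      have h1 := hW (π g) _ hw
      rw [← hc, hU]
      exact h1
    refine (hmin U hUn hUle).imp (fun h => ?_) (fun h => ?_)
    · rw [eq_bot_iff]
      intro v hv
      have := (hU v.toMul).2 hv
      rw [h, Subgroup.mem_bot] at this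
      exact (Submodule.mem_bot _).2 (hι (this.trans ι.map_one.symm))
    · rw [eq_top_iff]
      intro v _
      exact (hU v.toMul).1 (h ▸ hιk _)
  · refine nontrivial_H2_of_no_section ρ π hπ (ι.comp
      (MulEquiv.toMultiplicative_toAdditive (G := V)).toMonoidHom) ?_ ?_ ?_ hns
    · exact fun a b h => hι h
    · rw [← hker]
      ext x
      constructor
      · rintro ⟨v, rfl⟩
        exact ⟨_, rfl⟩
      · rintro ⟨v, rfl⟩
        exact ⟨Multiplicative.ofAdd (Additive.ofMul v), rfl⟩
    · intro e v
      exact (hc e v.toMul).symm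

theorem hasFrattiniModule_of_minimal_kernel {p q : ℕ} (hq : q.Prime)
    {S K : Type} [Group S] [Group K] [Finite K] [IsSimpleGroup S] (π : K →* S)
    (hπ : Function.Surjective π) (hqS : q ∣ Nat.card S)
    (hcomm : ∀ v ∈ π.ker, ∀ w ∈ π.ker, v * w = w * v) (hpow : ∀ v ∈ π.ker, v ^ p = 1)
    (hne : π.ker ≠ ⊥)
    (hmin : ∀ U : Subgroup K, U.Normal → U ≤ π.ker → U = ⊥ ∨ U = π.ker)
    (hns : ¬ ∃ s : S →* K, ∀ x, π (s x) = x)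
    (hfix : ∀ y : K, π y ≠ 1 → (∃ b : ℕ, orderOf (π y) = q ^ b) →
      ∀ v ∈ π.ker, y * v = v * y → v = 1) :
    HasFrattiniModule p q S := by
  obtain ⟨c, hc⟩ := exists_conj_action π hπ hcomm
  let _ : CommGroup π.ker :=
    { (inferInstance : Group π.ker) with
      mul_comm := fun a b => Subtype.ext (hcomm a a.2 b b.2) }
  let _ : Module (ZMod p) (Additive π.ker) := AddCommGroup.zmodModule (fun x =>
    Additive.toMul.injective (Subtype.ext (hpow _ x.toMul.2)))
  have : Finite S := Finite.of_surjective π hπ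
  have : Nontrivial π.ker := (Subgroup.nontrivial_iff_ne_bot _).2 hne
  exact hasFrattiniModule_of_extension hq π π.ker.subtype Subtype.val_injective
    (Subgroup.range_subtype _) hπ hqS c hc hmin hns hfix

/-- If an element `y` of `q`-power order normalizes a `q'`-subgroup `U` and fixes the coset
`U * x`, then it commutes with an element of this coset. -/
theorem exists_commute_mem_coset {G : Type*} [Group G] {q : ℕ} (hq : q.Prime) (U : Subgroup G)
    [Finite U] (hU : ¬ q ∣ Nat.card U) {y x : G} {b : ℕ} (hy : y ^ q ^ b = 1)
    (hn : ∀ u ∈ U, y * u * y⁻¹ ∈ U) (hx : y * x * y⁻¹ * x⁻¹ ∈ U) :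
    ∃ u ∈ U, y * (u * x) = u * x * y := by
  classical
  have : Fact q.Prime := ⟨hq⟩
  have : Fintype U := Fintype.ofFinite U
  have hmem : ∀ u ∈ U, y * (u * x) * y⁻¹ * x⁻¹ ∈ U := by
    intro u hu
    have := U.mul_mem (hn u hu) hx
    convert this using 1; group
  let f : Function.End U := fun u => ⟨y * (u * x) * y⁻¹ * x⁻¹, hmem u u.2⟩
  have hf : ∀ (n : ℕ) (u : U), (((f ^ n) u : U) : G) = y ^ n * (u * x) * (y ^ n)⁻¹ * x⁻¹ := by
    intro n
    induction n with
    | zero => intro u; simp; rfl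
    | succ n ih =>
      intro u
      rw [pow_succ]
      change (((f ^ n) (f u) : U) : G) = _
      rw [ih]
      change y ^ n * (y * (u * x) * y⁻¹ * x⁻¹ * x) * (y ^ n)⁻¹ * x⁻¹ = _
      rw [pow_succ]
      group
  have hfp : f ^ q ^ b = 1 := by
    funext u
    apply Subtype.ext
    rw [hf, hy]
    simp; rfl
  have h := Equiv.Perm.card_fixedPoints_modEq hfp
  have hne : Nonempty (Function.fixedPoints f) := by
    by_contra hemp
    rw [not_nonempty_iff] at hemp
    rw [Fintype.card_eq_zero (α := Function.fixedPoints f), Nat.modEq_zero_iff_dvd] at h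
    rw [Nat.card_eq_fintype_card] at hU
    exact hU h
  obtain ⟨u, hu⟩ := hne
  refine ⟨u, u.2, ?_⟩
  have h1 : y * (u * x) * y⁻¹ * x⁻¹ = u := congrArg Subtype.val hu
  rw [mul_inv_eq_iff_eq_mul, mul_inv_eq_iff_eq_mul] at h1
  exact h1

/-- A power of `g` with exponent prime to `q` has `q`-power order. -/
theorem exists_pow_qpow_eq_one {G : Type*} [Group G] [Finite G] {q : ℕ} (hq : q.Prime) (g : G) :
    ∃ m c : ℕ, ¬ q ∣ m ∧ (g ^ m) ^ q ^ c = 1 := by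
  obtain ⟨c, m, hm, h⟩ := Nat.exists_eq_pow_mul_and_not_dvd (orderOf_pos g).ne' q hq.ne_one
  exact ⟨m, c, hm, by rw [← pow_mul, mul_comm, ← h, pow_orderOf_eq_one]⟩

theorem pow_ne_one_of_not_dvd {G : Type*} [Group G] {q b m : ℕ} (hq : q.Prime) {g : G}
    (hg : g ≠ 1) (hb : g ^ q ^ b = 1) (hm : ¬ q ∣ m) : g ^ m ≠ 1 := by
  intro h
  apply hg
  rw [← orderOf_eq_one_iff]
  exact Nat.eq_one_of_dvd_coprimes ((hq.coprime_iff_not_dvd.2 hm).pow_left b)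
    (orderOf_dvd_of_pow_eq_one hb) (orderOf_dvd_of_pow_eq_one h)

theorem hasFrattiniModule_of_frattini_kernel {p q : ℕ} (hp : p.Prime) (hq : q.Prime) (hpq : p ≠ q)
    {S K : Type} [Group S] [Group K] [Finite K] [IsSimpleGroup S] (π : K →* S)
    (hπ : Function.Surjective π) (hqS : q ∣ Nat.card S)
    (hcomm : ∀ v ∈ π.ker, ∀ w ∈ π.ker, v * w = w * v) (hpow : IsPGroup p π.ker)
    (hne : π.ker ≠ ⊥)
    (hfrat : ∀ L : Subgroup K, L ⊔ π.ker = ⊤ → L = ⊤)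
    (hfix : ∀ y : K, π y ≠ 1 → (∃ b : ℕ, π y ^ q ^ b = 1) →
      ∀ v ∈ π.ker, y * v = v * y → v = 1) :
    HasFrattiniModule p q S := by
  have : Fact p.Prime := ⟨hp⟩
  obtain ⟨U, hU⟩ := (Set.toFinite {U : Subgroup K | U.Normal ∧ U < π.ker}).exists_maximal
    ⟨⊥, inferInstance, bot_lt_iff_ne_bot.2 hne⟩
  obtain ⟨⟨hUn, hUlt⟩, hUmax⟩ := hU
  let π' : K ⧸ U →* S := QuotientGroup.lift U π hUlt.le
  have hπ' : ∀ k, π' (QuotientGroup.mk' U k) = π k := fun k => rfl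
  have hmk := QuotientGroup.mk'_surjective U
  have hker : ∀ k, QuotientGroup.mk' U k ∈ π'.ker ↔ k ∈ π.ker := fun k => Iff.rfl
  have hsurj : Function.Surjective π' := fun s => by
    obtain ⟨k, rfl⟩ := hπ s
    exact ⟨_, hπ' k⟩
  have hne' : π'.ker ≠ ⊥ := by
    intro h
    apply hUlt.not_ge
    intro k hk
    rw [← hker, h, Subgroup.mem_bot] at hk
    exact (QuotientGroup.eq_one_iff k).1 hk
  have hcomm' : ∀ v ∈ π'.ker, ∀ w ∈ π'.ker, v * w = w * v := by
    intro v hv w hw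
    obtain ⟨v, rfl⟩ := hmk v
    obtain ⟨w, rfl⟩ := hmk w
    rw [← map_mul, hcomm v hv w hw, map_mul]
  have hpow' : IsPGroup p π'.ker := by
    rintro ⟨v, hv⟩
    obtain ⟨v, rfl⟩ := hmk v
    obtain ⟨k, hk⟩ := hpow ⟨v, hv⟩
    refine ⟨k, Subtype.ext ?_⟩
    have : v ^ p ^ k = 1 := congrArg Subtype.val hk
    change (QuotientGroup.mk' U v) ^ p ^ k = 1
    rw [← map_pow, this, map_one]
  have hmin : ∀ W : Subgroup (K ⧸ U), W.Normal → W ≤ π'.ker → W = ⊥ ∨ W = π'.ker := by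
    intro W hW hle
    by_cases h : W = π'.ker
    · exact Or.inr h
    left
    have h1 : W.comap (QuotientGroup.mk' U) ≤ U := by
      refine hUmax ⟨inferInstance, lt_of_le_of_ne (fun k hk => (hker k).1 (hle hk)) ?_⟩ ?_
      · intro he
        apply h
        refine le_antisymm hle fun v hv => ?_
        obtain ⟨v, rfl⟩ := hmk v
        rw [hker, ← he] at hv
        exact hv
      · intro u hu
        have h2 : QuotientGroup.mk' U u = 1 := (QuotientGroup.eq_one_iff u).2 hu
        rw [Subgroup.mem_comap, h2]
        exact W.one_mem
    rw [eq_bot_iff]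
    intro w hw
    obtain ⟨w, rfl⟩ := hmk w
    exact Subgroup.mem_bot.2 ((QuotientGroup.eq_one_iff w).2 (h1 hw))
  refine hasFrattiniModule_of_minimal_kernel hq π' hsurj hqS hcomm' ?_ hne' hmin ?_ ?_
  · let T : Subgroup (K ⧸ U) :=
      { carrier := {v | v ∈ π'.ker ∧ v ^ p = 1}
        one_mem' := ⟨one_mem _, one_pow _⟩
        mul_mem' := fun {a b} ha hb => ⟨mul_mem ha.1 hb.1, by
          rw [Commute.mul_pow (hcomm' a ha.1 b hb.1), ha.2, hb.2, one_mul]⟩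
        inv_mem' := fun {a} ha => ⟨inv_mem ha.1, by rw [inv_pow, ha.2, inv_one]⟩ }
    have hT : T.Normal := ⟨fun v hv g => ⟨Subgroup.Normal.conj_mem inferInstance v hv.1 g, by
      rw [conj_pow, hv.2]; simp⟩⟩
    have hTne : T ≠ ⊥ := by
      intro h
      have hnt : Nontrivial π'.ker := (Subgroup.nontrivial_iff_ne_bot _).2 hne'
      obtain ⟨v, hv⟩ := exists_prime_orderOf_dvd_card' p
        ((hpow'.nontrivial_iff_card.1 hnt).elim fun n hn => hn.2 ▸ dvd_pow_self p hn.1.ne')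
      have h1 : (v : K ⧸ U) ∈ T := ⟨v.2, by
        rw [← hv, ← Subgroup.coe_pow, pow_orderOf_eq_one, Subgroup.coe_one]⟩
      rw [h, Subgroup.mem_bot] at h1
      rw [show v = 1 from Subtype.ext h1, orderOf_one] at hv
      exact hp.one_lt.ne hv
    intro v hv
    rw [← (hmin T hT fun v hv => hv.1).resolve_left hTne] at hv
    exact hv.2
  · rintro ⟨s, hs⟩
    have h1 : s.range.comap (QuotientGroup.mk' U) = ⊤ := by
      apply hfrat
      rw [eq_top_iff]
      intro k _
      obtain ⟨l, hl⟩ := hmk (s (π k))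
      have h2 : π l = π k := by rw [← hπ', hl, hs]
      rw [← mul_inv_cancel_left l k]
      refine Subgroup.mul_mem_sup ⟨_, hl.symm⟩ ?_
      rw [MonoidHom.mem_ker, map_mul, map_inv, h2, inv_mul_cancel]
    apply hne'
    rw [eq_bot_iff]
    intro v hv
    obtain ⟨k, rfl⟩ := hmk v
    have h2 : k ∈ s.range.comap (QuotientGroup.mk' U) := h1 ▸ Subgroup.mem_top k
    obtain ⟨t, ht⟩ := h2
    rw [← ht, MonoidHom.mem_ker, hs] at hv
    rw [← ht, hv, map_one]
    exact Subgroup.mem_bot.2 rfl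
  · rintro y hy ⟨b, hb⟩ v hv hyv
    obtain ⟨k, rfl⟩ := hmk y
    obtain ⟨x, rfl⟩ := hmk v
    rw [hπ'] at hy hb
    obtain ⟨m, c, hm, hc⟩ := exists_pow_qpow_eq_one hq k
    have hb' : π k ^ q ^ b = 1 := hb ▸ pow_orderOf_eq_one _
    have hcm : Commute (QuotientGroup.mk' U (k ^ m)) (QuotientGroup.mk' U x) := by
      rw [map_pow]
      exact Commute.pow_left hyv m
    have hUp : IsPGroup p U := hpow.to_le hUlt.le
    have hqU : ¬ q ∣ Nat.card U := by
      intro hqU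
      obtain ⟨n, hn⟩ := IsPGroup.iff_card.1 hUp
      rw [hn] at hqU
      exact hpq ((Nat.prime_dvd_prime_iff_eq hq hp).1 (hq.dvd_of_dvd_pow hqU)).symm
    have hx : k ^ m * x * (k ^ m)⁻¹ * x⁻¹ ∈ U := by
      rw [← QuotientGroup.eq_one_iff]
      change QuotientGroup.mk' U _ = 1
      rw [map_mul, map_mul, map_mul, map_inv, map_inv, hcm.eq, mul_inv_cancel_right,
        mul_inv_cancel]
    obtain ⟨u, hu, hux⟩ :=
      exists_commute_mem_coset hq U hqU hc (fun u hu => hUn.conj_mem u hu _) hx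
    have h1 : u * x = 1 := by
      refine hfix (k ^ m) ?_ ⟨b, ?_⟩ (u * x) (mul_mem (hUlt.le hu) hv) hux
      · rw [map_pow]
        exact pow_ne_one_of_not_dvd hq hy hb' hm
      · rw [map_pow, ← pow_mul, mul_comm, pow_mul, hb', one_pow]
    refine (QuotientGroup.eq_one_iff x).2 ?_
    rw [eq_inv_of_mul_eq_one_right h1]
    exact inv_mem hu

/-- A nonsplit extension of a simple group by an abelian `p`-group with the fixed-point condition
provides one half of a Frattini triple. -/
theorem hasFrattiniModule_of_nonsplit {p q : ℕ} (hp : p.Prime) (hq : q.Prime) (hpq : p ≠ q)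
    {S E : Type} [Group S] [Group E] [Finite E] [IsSimpleGroup S] (π : E →* S)
    (hπ : Function.Surjective π) (hqS : q ∣ Nat.card S)
    (hcomm : ∀ v ∈ π.ker, ∀ w ∈ π.ker, v * w = w * v) (hpow : IsPGroup p π.ker)
    (hns : ∀ L : Subgroup E, L ⊔ π.ker = ⊤ → L ⊓ π.ker ≠ ⊥)
    (hfix : ∀ y : E, π y ≠ 1 → (∃ b : ℕ, π y ^ q ^ b = 1) →
      ∀ v ∈ π.ker, y * v = v * y → v = 1) :
    HasFrattiniModule p q S := by
  obtain ⟨K, hK, hKmin⟩ := (Set.toFinite {K : Subgroup E | K ⊔ π.ker = ⊤}).exists_minimal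
    ⟨⊤, top_sup_eq _⟩
  have hKsurj : ∀ s, ∃ k ∈ K, π k = s := by
    intro s
    obtain ⟨e, rfl⟩ := hπ s
    have he : e ∈ K ⊔ π.ker := by rw [hK]; exact Subgroup.mem_top e
    obtain ⟨k, hk, v, hv, rfl⟩ := Subgroup.mem_sup_of_normal_right.1 he
    exact ⟨k, hk, by rw [map_mul, MonoidHom.mem_ker.1 hv, mul_one]⟩
  refine hasFrattiniModule_of_frattini_kernel (K := K) hp hq hpq (π.comp K.subtype) ?_ hqS ?_ ?_ ?_
    ?_ ?_
  · intro s
    obtain ⟨k, hk, h⟩ := hKsurj s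
    exact ⟨⟨k, hk⟩, h⟩
  · exact fun v hv w hw => Subtype.ext (hcomm v hv w hw)
  · exact hpow.comap_of_injective K.subtype Subtype.val_injective
  · intro h
    refine hns K hK ?_
    rw [eq_bot_iff]
    rintro k ⟨hk, hkπ⟩
    have : (⟨k, hk⟩ : K) ∈ (π.comp K.subtype).ker := hkπ
    rw [h, Subgroup.mem_bot] at this
    exact Subgroup.mem_bot.2 (congrArg Subtype.val this)
  · intro L hL
    have h1 : L.map K.subtype ⊔ π.ker = ⊤ := by
      rw [eq_top_iff]
      intro e _
      obtain ⟨k, hk, h⟩ := hKsurj (π e)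
      have h2 : (⟨k, hk⟩ : K) ∈ L ⊔ (π.comp K.subtype).ker := hL ▸ Subgroup.mem_top _
      obtain ⟨l, hl, v, hv, hlv⟩ := Subgroup.mem_sup_of_normal_right.1 h2
      have h3 : (l : E) * v = k := congrArg Subtype.val hlv
      rw [← mul_inv_cancel_left (l : E) e]
      refine Subgroup.mul_mem_sup ⟨l, hl, rfl⟩ ?_
      have h4 : π v = 1 := hv
      rw [MonoidHom.mem_ker, map_mul, map_inv, ← h, ← h3, map_mul, h4, mul_one, inv_mul_cancel]
    have h2 : K ≤ L.map K.subtype := hKmin h1 (Subgroup.map_subtype_le _)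
    rw [eq_top_iff]
    intro k _
    obtain ⟨l, hl, h⟩ := h2 k.2
    rwa [← show l = k from Subtype.ext h]
  · intro y hy hb v hv hyv
    exact Subtype.ext (hfix y hy hb v hv (congrArg Subtype.val hyv))

/-- **Gaschütz' theorem**: an abelian normal subgroup `V` that has a complement in `H` has one in
the whole group when `|V|` is prime to the index of `H`. -/
theorem exists_complement_of_coprime_index {E : Type*} [Group E] [Finite E] {V H L : Subgroup E}
    [V.Normal] (hcomm : ∀ v ∈ V, ∀ w ∈ V, v * w = w * v)
    (hcop : (Nat.card V).Coprime H.index) (hsup : L ⊔ V = H) (hinf : L ⊓ V = ⊥) :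
    ∃ L' : Subgroup E, L' ⊔ V = ⊤ ∧ L' ⊓ V = ⊥ := by
  classical
  let _ : CommGroup V :=
    { (inferInstance : Group V) with mul_comm := fun a b => Subtype.ext (hcomm a a.2 b b.2) }
  let _ : Fintype (E ⧸ H) := Fintype.ofFinite _
  let c : E →* MulAut V := MulAut.conjNormal
  have hc : ∀ e v, ((c e v : V) : E) = e * v * e⁻¹ := fun e v => MulAut.conjNormal_apply e v
  have hcV : ∀ v w : V, c v w = w := fun v w => Subtype.ext (by
    rw [hc, hcomm v v.2 w w.2, mul_inv_cancel_right])
  have hVH : V ≤ H := hsup ▸ le_sup_right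
  have hLH : L ≤ H := hsup ▸ le_sup_left
  have hex : ∀ h : E, ∃ v : V, h ∈ H → (v : E)⁻¹ * h ∈ L := by
    intro h
    by_cases hh : h ∈ H
    · rw [← hsup, sup_comm] at hh
      obtain ⟨v, hv, l, hl, rfl⟩ := Subgroup.mem_sup_of_normal_left.1 hh
      exact ⟨⟨v, hv⟩, fun _ => by simpa using hl⟩
    · exact ⟨1, fun h' => absurd h' hh⟩
  choose φ hφ using hex
  have huniq : ∀ (h : E) (v : V), h ∈ H → (v : E)⁻¹ * h ∈ L → φ h = v := by
    intro h v hh hv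
    have h1 : (φ h : E)⁻¹ * v ∈ L ⊓ V := by
      refine ⟨?_, V.mul_mem (V.inv_mem (φ h).2) v.2⟩
      have := L.mul_mem (hφ h hh) (L.inv_mem hv)
      rwa [show (φ h : E)⁻¹ * h * ((v : E)⁻¹ * h)⁻¹ = (φ h : E)⁻¹ * v by group] at this
    rw [hinf, Subgroup.mem_bot, inv_mul_eq_one] at h1
    exact Subtype.ext h1
  have hφmul : ∀ g h, g ∈ H → h ∈ H → φ (g * h) = φ g * c g (φ h) := by
    intro g h hg hh
    refine huniq _ _ (H.mul_mem hg hh) ?_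
    have h1 := L.mul_mem (hφ g hg) (hφ h hh)
    have h2 := hcomm (φ g) (φ g).2 _ (c g (φ h)).2
    rw [Subgroup.coe_mul, h2, hc]
    convert h1 using 1
    simp only [mul_inv_rev, inv_inv, mul_assoc, inv_mul_cancel_left]
  have hφV : ∀ v : V, φ v = v := fun v => huniq _ _ (hVH v.2) (by simp [L.one_mem])
  let θ : E → V := fun g => φ (g⁻¹ * (g : E ⧸ H).out)
  have hθ : ∀ g h, h ∈ H → θ (g * h) = φ h⁻¹ * c h⁻¹ (θ g) := by
    intro g h hh
    have h1 : ((g * h : E) : E ⧸ H) = g := QuotientGroup.mk_mul_of_mem g hh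
    change φ ((g * h)⁻¹ * ((g * h : E) : E ⧸ H).out) = _
    rw [h1, ← hφmul _ _ (H.inv_mem hh) (QuotientGroup.eq.1 (QuotientGroup.out_eq' _).symm)]
    congr 1; group
  let T : E → E → V := fun g x => c x ((θ x)⁻¹ * θ (g⁻¹ * x))
  have hT : ∀ g x h, h ∈ H → T g (x * h) = T g x := by
    intro g x h hh
    change c (x * h) ((θ (x * h))⁻¹ * θ (g⁻¹ * (x * h))) = _
    rw [← mul_assoc g⁻¹, hθ _ _ hh, hθ _ _ hh, mul_inv, mul_mul_mul_comm, inv_mul_cancel, one_mul,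
      ← map_inv (c h⁻¹), ← map_mul (c h⁻¹), map_mul c x h, MulAut.mul_apply,
      ← MulAut.mul_apply _ (c h) (c h⁻¹),
      ← map_mul c, mul_inv_cancel, map_one, MulAut.one_apply]
  have hTmk : ∀ (g x : E), T g (x : E ⧸ H).out = T g x := by
    intro g x
    have h1 : x⁻¹ * (x : E ⧸ H).out ∈ H := QuotientGroup.eq.1 (QuotientGroup.out_eq' _).symm
    rw [← hT g x _ h1, mul_inv_cancel_left]
  have hTmul : ∀ g g' x, T (g * g') x = T g x * c g (T g' (g⁻¹ * x)) := by
    intro g g' x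
    change _ = _ * c g (c (g⁻¹ * x) _)
    rw [← MulAut.mul_apply, ← map_mul c, mul_inv_cancel_left, ← map_mul (c x)]
    change c x _ = _
    congr 1
    rw [mul_inv_rev, mul_assoc g'⁻¹]
    group
  have hTV : ∀ (v : V) x, T v x = v := by
    intro v x
    have h1 : (v : E)⁻¹ * x = x * (c x⁻¹ v⁻¹ : V) := by
      rw [hc]; simp [mul_assoc]
    have h2 : θ ((v : E)⁻¹ * x) = c x⁻¹ v * θ x := by
      rw [h1, hθ _ _ (hVH (Subtype.mem _)), ← Subgroup.coe_inv, ← map_inv (c x⁻¹), inv_inv, hφV,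
        hcV]
    change c x _ = _
    rw [h2, mul_comm, mul_inv_cancel_right, ← MulAut.mul_apply, ← map_mul, mul_inv_cancel,
      map_one, MulAut.one_apply]
  let ψ : E → V := fun g => ∏ X : E ⧸ H, T g X.out
  have hψmul : ∀ g g', ψ (g * g') = ψ g * c g (ψ g') := by
    intro g g'
    change ∏ X : E ⧸ H, T (g * g') X.out = (∏ X : E ⧸ H, T g X.out) * c g (∏ X : E ⧸ H, T g' X.out)
    simp_rw [hTmul, Finset.prod_mul_distrib, map_prod]
    congr 1
    refine Fintype.prod_equiv (MulAction.toPerm g⁻¹) _ _ fun X => ?_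
    have h1 : (MulAction.toPerm g⁻¹ X : E ⧸ H) = ((g⁻¹ * X.out : E) : E ⧸ H) := by
      conv_lhs => rw [← QuotientGroup.out_eq' X]
      rfl
    rw [h1, hTmk]
  have hψV : ∀ v : V, ψ v = v ^ H.index := by
    intro v
    change ∏ X : E ⧸ H, T v X.out = _
    simp_rw [hTV]
    rw [Finset.prod_const, Subgroup.index, Nat.card_eq_fintype_card, Finset.card_univ]
  have hψ1 : ψ 1 = 1 := by simpa using hψV 1
  refine ⟨{ carrier := {g | ψ g = 1}
            one_mem' := hψ1
            mul_mem' := fun {a b} ha hb => by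
              change ψ (a * b) = 1
              rw [hψmul, show ψ a = 1 from ha, show ψ b = 1 from hb, map_one, one_mul]
            inv_mem' := fun {a} ha => by
              have h1 := hψmul a⁻¹ a
              rw [inv_mul_cancel, hψ1, show ψ a = 1 from ha, map_one, mul_one] at h1
              exact h1.symm }, ?_, ?_⟩
  · rw [eq_top_iff]
    intro g _
    obtain ⟨v, hv⟩ := (powCoprime hcop).surjective (ψ g)
    have hv' : v ^ H.index = ψ g := hv
    have h1 : (v : E)⁻¹ * g ∈ ({g | ψ g = 1} : Set E) := by
      change ψ _ = 1
      rw [hψmul, ← Subgroup.coe_inv, hψV, hcV, ← hv', inv_pow, inv_mul_cancel]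
    rw [sup_comm, ← mul_inv_cancel_left (v : E) g]
    exact Subgroup.mul_mem_sup v.2 h1
  · rw [eq_bot_iff]
    rintro v ⟨hv, hvV⟩
    have h1 : ψ v = 1 := hv
    rw [show v = ((⟨v, hvV⟩ : V) : E) from rfl, hψV] at h1
    have h2 : (⟨v, hvV⟩ : V) = 1 := (powCoprime hcop).injective (h1.trans (one_pow _).symm)
    exact Subgroup.mem_bot.2 (congrArg Subtype.val h2)

/-- Two complements of an abelian normal Hall subgroup are conjugate. -/
theorem exists_conj_mem_of_complement {E : Type*} [Group E] [Finite E] {V B C : Subgroup E}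
    [V.Normal] (hcomm : ∀ v ∈ V, ∀ w ∈ V, v * w = w * v)
    (hcop : (Nat.card V).Coprime (Nat.card B)) (hBC : B ≤ C ⊔ V) (hC : C ⊓ V = ⊥) :
    ∃ v ∈ V, ∀ b ∈ B, v⁻¹ * b * v ∈ C := by
  classical
  let _ : CommGroup V :=
    { (inferInstance : Group V) with mul_comm := fun a b => Subtype.ext (hcomm a a.2 b b.2) }
  let _ : Fintype B := Fintype.ofFinite _
  let c : E →* MulAut V := MulAut.conjNormal
  have hc : ∀ e v, ((c e v : V) : E) = e * v * e⁻¹ := fun e v => MulAut.conjNormal_apply e v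
  have hex : ∀ b : B, ∃ v : V, (v : E)⁻¹ * b ∈ C := by
    intro b
    have hb := hBC b.2
    rw [sup_comm] at hb
    obtain ⟨v, hv, l, hl, h⟩ := Subgroup.mem_sup_of_normal_left.1 hb
    exact ⟨⟨v, hv⟩, by rw [← h]; simpa using hl⟩
  choose β hβ using hex
  have hmul : ∀ a b : B, β (a * b) = β a * c a (β b) := by
    intro a b
    have h1 : (β (a * b) : E)⁻¹ * (β a * c a (β b) : V) ∈ C ⊓ V := by
      refine ⟨?_, V.mul_mem (V.inv_mem (Subtype.mem _)) (Subtype.mem _)⟩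
      have h1 := C.mul_mem (hβ (a * b)) (C.inv_mem (C.mul_mem (hβ a) (hβ b)))
      have h2 := hcomm (β a) (β a).2 _ (c a (β b)).2
      rw [Subgroup.coe_mul, h2, hc]
      change _ ∈ C
      convert h1 using 1
      rw [Subgroup.coe_mul]
      group
    rw [hC, Subgroup.mem_bot, inv_mul_eq_one] at h1
    exact Subtype.ext h1
  let u : V := ∏ b : B, β b
  have hu : ∀ a : B, u = β a ^ Nat.card B * c a u := by
    intro a
    calc u = ∏ b : B, β (a * b) := (Fintype.prod_equiv (Equiv.mulLeft a) _ _ fun _ => rfl).symm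
      _ = _ := by
        simp_rw [hmul, Finset.prod_mul_distrib, Finset.prod_const, Finset.card_univ,
          Nat.card_eq_fintype_card, u, map_prod]
  obtain ⟨w, hw⟩ := (powCoprime hcop).surjective u
  have hw' : w ^ Nat.card B = u := hw
  have hβw : ∀ a : B, w = β a * c a w := by
    intro a
    apply (powCoprime hcop).injective
    change w ^ Nat.card B = (β a * c a w) ^ Nat.card B
    rw [mul_pow, ← map_pow, hw', ← hu]
  refine ⟨w, w.2, fun b hb => ?_⟩
  have h1 : (w : E) = β ⟨b, hb⟩ * (b * w * b⁻¹) := by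
    have := congrArg (Subtype.val) (hβw ⟨b, hb⟩)
    rwa [Subgroup.coe_mul, hc] at this
  have h2 := hβ ⟨b, hb⟩
  have h3 : (β ⟨b, hb⟩ : E) = b * (w : E)⁻¹ * b⁻¹ * w := by
    have h4 : β ⟨b, hb⟩ = (c b w)⁻¹ * w := by
      rw [eq_inv_mul_iff_mul_eq, mul_comm]
      exact (hβw ⟨b, hb⟩).symm
    rw [h4, Subgroup.coe_mul, Subgroup.coe_inv, hc]
    group
  rw [h3] at h2
  convert h2 using 1
  group

/-- If `V` is an abelian normal subgroup consisting of nongenerators, then a normal subgroup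
containing `V` as a Hall subgroup is the internal product of `V` and a normal subgroup. -/
theorem exists_normal_complement {E : Type*} [Group E] [Finite E] {V N : Subgroup E}
    [V.Normal] [N.Normal] (hcomm : ∀ v ∈ V, ∀ w ∈ V, v * w = w * v) (hVN : V ≤ N)
    (hcop : (Nat.card V).Coprime (V.relIndex N))
    (hgen : ∀ K : Subgroup E, K ⊔ V = ⊤ → K = ⊤) :
    ∃ B : Subgroup E, B.Normal ∧ B ⊔ V = N ∧ B ⊓ V = ⊥ := by
  have hcard : Nat.card (V.subgroupOf N) = Nat.card V :=
    Nat.card_congr (Subgroup.subgroupOfEquivOfLe hVN).toEquiv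
  obtain ⟨B', hB'⟩ := Subgroup.exists_right_complement'_of_coprime (N := V.subgroupOf N)
    (by rw [hcard]; exact hcop)
  have hBcard : Nat.card (B'.map N.subtype) = V.relIndex N := by
    rw [Subgroup.card_map_of_injective N.subtype_injective]
    exact hB'.symm.index_eq_card.symm
  have hinf : B'.map N.subtype ⊓ V = ⊥ := by
    rw [eq_bot_iff]
    rintro _ ⟨⟨b, hb, rfl⟩, hbV⟩
    have : b ∈ V.subgroupOf N ⊓ B' := ⟨hbV, hb⟩
    rw [hB'.isCompl.inf_eq_bot, Subgroup.mem_bot] at this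
    rw [this]
    exact Subgroup.mem_bot.2 rfl
  have hsup : B'.map N.subtype ⊔ V = N := by
    refine le_antisymm (sup_le (Subgroup.map_subtype_le _) hVN) fun n hn => ?_
    have h1 : (⟨n, hn⟩ : N) ∈ B' ⊔ V.subgroupOf N := by
      rw [sup_comm, hB'.isCompl.sup_eq_top]; exact Subgroup.mem_top _
    obtain ⟨b, hb, v, hv, h⟩ := Subgroup.mem_sup_of_normal_right.1 h1
    rw [show n = (b : E) * v from congrArg Subtype.val h.symm]
    exact Subgroup.mul_mem_sup ⟨b, hb, rfl⟩ hv
  set B := B'.map N.subtype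
  refine ⟨B, ?_, hsup, hinf⟩
  rw [← Subgroup.normalizer_eq_top_iff]
  apply hgen
  rw [eq_top_iff]
  intro e _
  have hle : B ≤ B.map (MulAut.conj e).toMonoidHom ⊔ V := by
    intro b hb
    have hbN : e⁻¹ * b * e ∈ N := by
      have := Subgroup.Normal.conj_mem (inferInstance : N.Normal) b
        (hsup ▸ Subgroup.mem_sup_left hb) e⁻¹
      simpa using this
    rw [← hsup] at hbN
    obtain ⟨b', hb', w, hw, h⟩ := Subgroup.mem_sup_of_normal_right.1 hbN
    have h5 : b = (e * b' * e⁻¹) * (e * w * e⁻¹) := by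
      calc b = e * (e⁻¹ * b * e) * e⁻¹ := by group
        _ = _ := by rw [← h]; group
    rw [h5]
    exact Subgroup.mul_mem_sup ⟨b', hb', rfl⟩
      (Subgroup.Normal.conj_mem (inferInstance : V.Normal) w hw e)
  have hbot : B.map (MulAut.conj e).toMonoidHom ⊓ V = ⊥ := by
    rw [eq_bot_iff]
    rintro _ ⟨⟨b, hb, rfl⟩, hbV⟩
    have h1 : e * b * e⁻¹ ∈ V := hbV
    have h2 : b ∈ B ⊓ V := by
      refine ⟨hb, ?_⟩
      have := Subgroup.Normal.conj_mem (inferInstance : V.Normal) _ h1 e⁻¹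
      simpa [mul_assoc] using this
    rw [hinf, Subgroup.mem_bot] at h2
    rw [h2]
    simp
  obtain ⟨v, hv, h⟩ := exists_conj_mem_of_complement (V := V) (B := B)
    (C := B.map (MulAut.conj e).toMonoidHom) hcomm (hBcard ▸ hcop) hle hbot
  have h1 : (v * e)⁻¹ ∈ Subgroup.normalizer (B : Set E) := by
    refine Subgroup.mem_normalizer_fintype fun b hb => ?_
    obtain ⟨b', hb', h2⟩ := h b hb
    have h3 : e * b' * e⁻¹ = v⁻¹ * b * v := h2
    have h4 : (v * e)⁻¹ * b * (v * e)⁻¹⁻¹ = b' := by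
      calc _ = e⁻¹ * (v⁻¹ * b * v) * e := by group
        _ = _ := by rw [← h3]; group
    rw [h4]
    exact hb'
  rw [sup_comm, ← inv_mul_cancel_left v e]
  exact Subgroup.mul_mem_sup (V.inv_mem hv) (by simpa using inv_mem h1)

/-- If commuting elements `x, y` of prime order `p` act on an abelian group without `p`-torsion such
that nontrivial elements act fixed-point-freely, then `y` is a power of `x`. -/
theorem mem_zpowers_of_fixedPointFree {p : ℕ} {R V : Type*} [Group R] [CommGroup V]
    [Nontrivial V] (hp : p.Prime) (c : R →* MulAut V)
    (hfix : ∀ r : R, r ≠ 1 → ∀ v, c r v = v → v = 1) (htors : ∀ v : V, v ^ p = 1 → v = 1)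
    {x y : R} (hxy : Commute x y) (hx : x ^ p = 1) (hy : y ^ p = 1) (hx1 : x ≠ 1) :
    y ∈ Subgroup.zpowers x := by
  have _ : Fact p.Prime := ⟨hp⟩
  by_contra hyx
  have hprod : ∀ z : R, z ≠ 1 → z ^ p = 1 → ∀ v, ∏ i ∈ Finset.range p, c (z ^ i) v = 1 := by
    intro z hz hzp v
    apply hfix z hz
    rw [map_prod]
    have h1 : ∀ i, c z (c (z ^ i) v) = c (z ^ (i + 1)) v := fun i => by
      rw [← MulAut.mul_apply, ← map_mul, pow_succ']
    simp_rw [h1]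
    have h2 := Finset.prod_range_succ (fun i => c (z ^ i) v) p
    rw [Finset.prod_range_succ', hzp, pow_zero] at h2
    exact mul_right_cancel h2
  have hxi : ∀ i, 0 < i → i < p → x ^ i ≠ 1 := by
    intro i h0 hi h
    have h1 := orderOf_dvd_of_pow_eq_one h
    rw [orderOf_eq_prime hx hx1] at h1
    exact absurd (Nat.le_of_dvd h0 h1) (by omega)
  obtain ⟨v, hv⟩ := exists_ne (1 : V)
  refine hv (htors v ?_)
  have h1 : ∏ j ∈ Finset.range p, ∏ i ∈ Finset.range p, c ((x ^ j * y) ^ i) v = 1 := by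
    refine Finset.prod_eq_one fun j _ => hprod _ (fun h => hyx ?_) ?_ v
    · rw [eq_inv_of_mul_eq_one_right h]
      exact inv_mem (pow_mem (Subgroup.mem_zpowers x) j)
    · rw [(hxy.pow_left j).mul_pow, hy, mul_one, ← pow_mul, mul_comm, pow_mul, hx, one_pow]
  rw [Finset.prod_comm] at h1
  have h2 : ∀ i j, c ((x ^ j * y) ^ i) v = c ((x ^ i) ^ j) (c (y ^ i) v) := fun i j => by
    rw [(hxy.pow_left j).mul_pow, map_mul, MulAut.mul_apply, ← pow_mul, ← pow_mul, mul_comm i j]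
  simp_rw [h2] at h1
  rw [Finset.prod_eq_single 0] at h1
  · simpa using h1
  · intro i hi h0
    refine hprod _ (hxi i (Nat.pos_of_ne_zero h0) (Finset.mem_range.1 hi)) ?_ _
    rw [← pow_mul, mul_comm, pow_mul, hx, one_pow]
  · exact fun h => absurd (Finset.mem_range.2 hp.pos) h

/-- The power formula in a group of class two. -/
theorem mul_pow_eq_of_commute_commutator {G : Type*} [Group G] {x y z : G} (h : y * x = x * y * z)
    (hx : Commute z x) (hy : Commute z y) (n : ℕ) :
    (x * y) ^ n = x ^ n * y ^ n * z ^ n.choose 2 := by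
  have h1 : ∀ n : ℕ, y ^ n * x = x * y ^ n * z ^ n := by
    intro n
    induction n with
    | zero => simp
    | succ n ih =>
      rw [pow_succ' y, mul_assoc, ih, ← mul_assoc, ← mul_assoc, h, mul_assoc (x * y),
        (hy.pow_right n).eq, pow_succ' z]
      simp only [mul_assoc]
  induction n with
  | zero => simp
  | succ n ih =>
    have h2 : Commute (z ^ n.choose 2) (x * y) := (hx.mul_right hy).pow_left _
    have h3 : Commute (z ^ n) y := hy.pow_left n
    calc (x * y) ^ (n + 1) = x ^ n * y ^ n * (z ^ n.choose 2 * (x * y)) := by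
          rw [pow_succ, ih, mul_assoc]
      _ = x ^ n * (y ^ n * x) * y * z ^ n.choose 2 := by rw [h2.eq]; simp only [mul_assoc]
      _ = x ^ n * x * y ^ n * (z ^ n * y) * z ^ n.choose 2 := by
          rw [h1]; simp only [mul_assoc]
      _ = _ := by
          rw [h3.eq, pow_succ, pow_succ, Nat.choose_succ_succ' n 1, Nat.choose_one_right, pow_add]
          simp only [mul_assoc]

/-- For odd `p`, a finite `p`-group without noncyclic subgroups of exponent `p` and order `p ^ 2` is
cyclic. -/
theorem IsPGroup.isCyclic_of_mem_zpowers {p : ℕ} (hp : p.Prime) (hodd : Odd p) :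
    ∀ (n : ℕ) {R : Type*} [Group R] [Finite R], Nat.card R = p ^ n →
      (∀ x y : R, Commute x y → x ^ p = 1 → y ^ p = 1 → x ≠ 1 → y ∈ Subgroup.zpowers x) →
      IsCyclic R := by
  have _ : Fact p.Prime := ⟨hp⟩
  intro n
  induction n with
  | zero =>
    intro R _ _ hR _
    have := (Nat.card_eq_one_iff_unique.1 (hR.trans (pow_zero p))).1
    infer_instance
  | succ n ih =>
    intro R _ _ hR h
    by_contra hnc
    have hindex : ∀ M : Subgroup R, Nat.card M = p ^ n → M.index = p := by
      intro M hM
      have h1 := M.card_mul_index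
      rw [hM, hR, pow_succ] at h1
      exact Nat.eq_of_mul_eq_mul_left (pow_pos hp.pos n) h1
    have hcyc : ∀ M : Subgroup R, Nat.card M = p ^ n → IsCyclic M := by
      intro M hM
      refine ih hM fun x y hxy hx hy hx1 => ?_
      obtain ⟨k, hk⟩ := h x y (congrArg Subtype.val hxy) (by exact_mod_cast congrArg Subtype.val hx)
        (by exact_mod_cast congrArg Subtype.val hy) (by simpa using hx1)
      exact ⟨k, Subtype.ext (by simpa using hk)⟩
    have hnormal : ∀ M : Subgroup R, Nat.card M = p ^ n → M.Normal := by
      intro M hM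
      refine Subgroup.normal_of_index_eq_minFac_card ?_
      rw [hindex M hM, hR, hp.pow_minFac n.succ_ne_zero]
    have hquot : ∀ M : Subgroup R, Nat.card M = p ^ n →
        (∀ x y : R, (x * y)⁻¹ * (y * x) ∈ M) ∧ ∀ x : R, x ^ p ∈ M := by
      intro M hM
      have := hnormal M hM
      have hc : Nat.card (R ⧸ M) = p := hindex M hM
      have := isCyclic_of_prime_card hc
      refine ⟨fun x y => ?_, fun x => ?_⟩
      · rw [← QuotientGroup.eq]
        exact mul_comm' (x : R ⧸ M) (y : R ⧸ M)
      · rw [← QuotientGroup.eq_one_iff, QuotientGroup.mk_pow, ← hc, pow_card_eq_one']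
    obtain ⟨M, hM⟩ := Sylow.exists_subgroup_card_pow_prime p (G := R) (n := n)
      (hR ▸ pow_dvd_pow p n.le_succ)
    obtain ⟨x, hx⟩ : ∃ x, x ∉ M := by
      by_contra! hall
      have : M = ⊤ := eq_top_iff.2 fun x _ => hall x
      have h1 := hindex M hM
      rw [this, Subgroup.index_top] at h1
      exact hp.one_lt.ne h1
    obtain ⟨N, hN, hxN⟩ : ∃ N : Subgroup R, Nat.card N = p ^ n ∧ x ∈ N := by
      obtain ⟨k, hk⟩ := (IsPGroup.of_card hR).to_subgroup (Subgroup.zpowers x) |>.exists_card_eq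
      have hkn : k ≤ n := by
        by_contra! hlt
        refine hnc ⟨x, fun y => ?_⟩
        have : Subgroup.zpowers x = ⊤ := Subgroup.eq_top_of_le_card _ (by
          rw [hk, hR]; exact Nat.pow_le_pow_right hp.pos hlt)
        exact this.ge (Subgroup.mem_top y)
      obtain ⟨N, hN, hle⟩ := Sylow.exists_subgroup_card_pow_prime_le p (G := R) (n := k) (m := n)
        (hR ▸ pow_dvd_pow p n.le_succ) (Subgroup.zpowers x) hk hkn
      exact ⟨N, hN, hle (Subgroup.mem_zpowers x)⟩
    have hcentral : ∀ d ∈ M ⊓ N, ∀ r : R, Commute d r := by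
      rintro d ⟨hdM, hdN⟩ r
      have hcomm : ∀ K : Subgroup R, Nat.card K = p ^ n → d ∈ K →
          K ≤ Subgroup.centralizer {d} := by
        intro K hK hd k hk
        have := hcyc K hK
        rw [Subgroup.mem_centralizer_singleton_iff]
        exact congrArg Subtype.val (mul_comm' (⟨k, hk⟩ : K) ⟨d, hd⟩)
      have h1 : Subgroup.centralizer {d} = ⊤ := by
        have h2 := hcomm M hM hdM
        by_contra h3
        have h4 : (Subgroup.centralizer {d}).index ∣ p := hindex M hM ▸ Subgroup.index_dvd_of_le h2
        rcases (Nat.dvd_prime hp).1 h4 with h5 | h5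
        · exact h3 (Subgroup.index_eq_one.1 h5)
        · have h6 : M = Subgroup.centralizer {d} := by
            refine Subgroup.eq_of_le_of_card_ge h2 (le_of_eq ?_)
            have h7 := M.card_mul_index
            rw [← (Subgroup.centralizer {d}).card_mul_index, h5, hindex M hM] at h7
            exact (Nat.eq_of_mul_eq_mul_right hp.pos h7).symm
          exact hx (h6 ▸ hcomm N hN hdN hxN)
      have h2 : r ∈ Subgroup.centralizer {d} := h1 ▸ Subgroup.mem_top r
      exact (Subgroup.mem_centralizer_singleton_iff.1 h2).symm
    have hz : ∀ x y : R, (x * y)⁻¹ * (y * x) ∈ M ⊓ N := fun x y =>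
      ⟨(hquot M hM).1 x y, (hquot N hN).1 x y⟩
    have hpD : ∀ x : R, x ^ p ∈ M ⊓ N := fun x => ⟨(hquot M hM).2 x, (hquot N hN).2 x⟩
    have hzp : ∀ x y : R, ((x * y)⁻¹ * (y * x)) ^ p = 1 := by
      intro x y
      set z := (x * y)⁻¹ * (y * x)
      have hzc := hcentral z (hz x y)
      have h1 : y * x = x * y * z := (mul_inv_cancel_left _ _).symm
      have h2 : y * x * y⁻¹ = x * z := by rw [h1, mul_assoc, (hzc y⁻¹).eq]; group
      have h3 : (y * x * y⁻¹) ^ p = x ^ p := by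
        rw [conj_pow, ← (hcentral _ (hpD x) y).eq, mul_inv_cancel_right]
      rw [h2, (hzc x).symm.mul_pow] at h3
      exact mul_eq_left.1 h3
    let φ : R →* R := MonoidHom.mk' (fun x => x ^ p) fun x y => by
      rw [mul_pow_eq_of_commute_commutator (mul_inv_cancel_left (x * y) (y * x)).symm
        (hcentral _ (hz x y) x) (hcentral _ (hz x y) y)]
      obtain ⟨k, hk⟩ := hp.dvd_choose_self two_ne_zero
        (lt_of_le_of_ne hp.two_le fun h2 => by rw [← h2] at hodd; exact absurd hodd (by decide))
      rw [hk, pow_mul, hzp, one_pow, mul_one]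
    have hrange : φ.range ≤ M ⊓ N := by
      rintro _ ⟨x, rfl⟩
      exact hpD x
    have hlt : Nat.card φ.range < p ^ n := by
      refine lt_of_le_of_lt (Subgroup.card_le_of_le hrange) ?_
      rw [← hN]
      refine lt_of_le_of_ne (Subgroup.card_le_of_le inf_le_right) fun h1 => hx ?_
      have h2 := Subgroup.eq_of_le_of_card_ge (inf_le_right : M ⊓ N ≤ N) h1.ge
      exact (h2.ge hxN).1
    have hker : p < Nat.card φ.ker := by
      have h1 := φ.ker.card_mul_index
      rw [Subgroup.index_ker, hR, pow_succ'] at h1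
      by_contra! h2
      exact absurd h1 (Nat.mul_lt_mul_of_le_of_lt h2 hlt hp.pos).ne
    have : Nontrivial φ.ker := Finite.one_lt_card_iff_nontrivial.1 (hp.one_lt.trans hker)
    have : Nontrivial (Subgroup.center φ.ker) :=
      ((IsPGroup.of_card hR).to_subgroup φ.ker).center_nontrivial
    obtain ⟨⟨⟨w, hw⟩, hwc⟩, hw1⟩ := exists_ne (1 : Subgroup.center φ.ker)
    have hw1' : w ≠ 1 := fun h1 => hw1 (Subtype.ext (Subtype.ext h1))
    have hle : φ.ker ≤ Subgroup.zpowers w := fun y hy =>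
      h w y (congrArg Subtype.val (Subgroup.mem_center_iff.1 hwc ⟨y, hy⟩)).symm hw hy hw1'
    have h1 := Subgroup.card_le_of_le hle
    rw [Nat.card_zpowers, orderOf_eq_prime (p := p) hw hw1'] at h1
    omega

/-- For odd `p`, a finite `p`-group acting faithfully on an abelian group without `p`-torsion such
that nontrivial elements act fixed-point-freely is cyclic. -/
theorem IsPGroup.isCyclic_of_fixedPointFree {p : ℕ} {R V : Type*} [Group R] [Finite R] [CommGroup V]
    [Nontrivial V] (hp : p.Prime) (hodd : Odd p) (hR : IsPGroup p R) (c : R →* MulAut V)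
    (hfix : ∀ r : R, r ≠ 1 → ∀ v, c r v = v → v = 1) (htors : ∀ v : V, v ^ p = 1 → v = 1) :
    IsCyclic R := by
  have _ : Fact p.Prime := ⟨hp⟩
  obtain ⟨n, hn⟩ := hR.exists_card_eq
  exact IsPGroup.isCyclic_of_mem_zpowers hp hodd n hn fun x y hxy hx hy hx1 =>
    mem_zpowers_of_fixedPointFree hp c hfix htors hxy hx hy hx1

theorem commute_pow_eq_one_of_not_dvd_orderOf {Γ : Type*} [Group Γ] {p q : ℕ} (hp : p.Prime)
    (hq : q.Prime) (hpq : p ≠ q) (h1 : ∀ g : Γ, ¬ p * q ∣ orderOf g) {x y : Γ}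
    (hxy : Commute x y) (hx : orderOf x = p) (hy : orderOf y = q) : False :=
  h1 (x * y) (by rw [hxy.orderOf_mul_eq_mul_orderOf_of_coprime
    (by rw [hx, hy]; exact (Nat.coprime_primes hp hq).2 hpq), hx, hy])

/-- A finite group has a largest normal subgroup of order prime to `p`, and it is
characteristic. -/
theorem exists_characteristic_not_dvd_card {N : Type*} [Group N] [Finite N] {p : ℕ}
    (hp : p.Prime) : ∃ K : Subgroup N, K.Characteristic ∧ ¬ p ∣ Nat.card K ∧
      ∀ T : Subgroup N, T.Normal → ¬ p ∣ Nat.card T → T ≤ K := by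
  obtain ⟨K, ⟨hKn, hKp⟩, hmax⟩ := Set.Finite.exists_maximal
    (s := {K : Subgroup N | K.Normal ∧ ¬ p ∣ Nat.card K}) (Set.toFinite _)
    ⟨⊥, inferInstance, by simpa using hp.one_lt.ne'⟩
  have hle : ∀ T : Subgroup N, T.Normal → ¬ p ∣ Nat.card T → T ≤ K := by
    intro T hT hTp
    refine le_trans le_sup_left (hmax (y := T ⊔ K) ⟨inferInstance, fun h => ?_⟩ le_sup_right)
    rw [← Subgroup.card_mul_index (K.subgroupOf (T ⊔ K)), ← Subgroup.relIndex,
      Subgroup.relIndex_sup_right,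
      Nat.card_congr (Subgroup.subgroupOfEquivOfLe (le_sup_right : K ≤ T ⊔ K)).toEquiv] at h
    rcases hp.dvd_mul.1 h with h | h
    · exact hKp h
    · exact hTp (h.trans (Subgroup.relIndex_dvd_card K T))
  refine ⟨K, ?_, hKp, hle⟩
  rw [Subgroup.characteristic_iff_map_le]
  intro φ
  refine hle _ (hKn.map φ.toMonoidHom φ.surjective) ?_
  rwa [Subgroup.card_map_of_injective φ.injective]

/-- If no element of a nontrivial finite group `Γ` has order divisible by `p * q`, but every
nontrivial normal subgroup has order divisible by `p` and by `q`, then `Γ` has a simple nonabelian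
normal subgroup. -/
theorem exists_normal_isSimpleGroup {Γ : Type*} [Group Γ] [Finite Γ] [Nontrivial Γ] {p q : ℕ}
    (hp : p.Prime) (hq : q.Prime) (hpq : p ≠ q) (h1 : ∀ g : Γ, ¬ p * q ∣ orderOf g)
    (h2 : ∀ N : Subgroup Γ, N.Normal → N ≠ ⊥ → p ∣ Nat.card N ∧ q ∣ Nat.card N) :
    ∃ N : Subgroup Γ, N.Normal ∧ IsSimpleGroup N ∧ ¬ (∀ a b : N, a * b = b * a) ∧
      p ∣ Nat.card N ∧ q ∣ Nat.card N := by
  have _ : Fact p.Prime := ⟨hp⟩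
  have _ : Fact q.Prime := ⟨hq⟩
  obtain ⟨N, ⟨hNn, hN1⟩, hmin⟩ := Set.Finite.exists_minimal
    (s := {K : Subgroup Γ | K.Normal ∧ K ≠ ⊥}) (Set.toFinite _)
    ⟨⊤, inferInstance, top_ne_bot⟩
  obtain ⟨hpN, hqN⟩ := h2 N hNn hN1
  have hNnt : Nontrivial N := (Subgroup.nontrivial_iff_ne_bot N).2 hN1
  have hdvd : ∀ r : ℕ, r.Prime → (∀ K : Subgroup Γ, K.Normal → K ≠ ⊥ → r ∣ Nat.card K) →
      ∀ T : Subgroup N, T.Normal → T ≠ ⊥ → r ∣ Nat.card T := by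
    intro r hr h T hTn hT1
    by_contra hT
    obtain ⟨K, hKc, hKr, hK⟩ := exists_characteristic_not_dvd_card (N := N) hr
    have hKT := hK T hTn hT
    refine hKr ?_
    rw [← Subgroup.card_map_of_injective (K := K) N.subtype_injective]
    refine h _ inferInstance fun h3 => hT1 ?_
    rw [Subgroup.map_eq_bot_iff_of_injective _ N.subtype_injective] at h3
    exact le_bot_iff.1 (h3 ▸ hKT)
  have hNc : ∀ T : Subgroup N, T.Normal → T ≠ ⊥ → (∀ L : Subgroup N, L.Normal → L ≠ ⊥ → L ≤ T →
      L = T) → T = ⊤ := by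
    intro T hTn hT1 hTmin
    have hconj : ∀ g : Γ, T.map (MulAut.conjNormal g : MulAut N).toMonoidHom ≤ T := by
      intro g
      set U := T.map (MulAut.conjNormal g : MulAut N).toMonoidHom
      have hUn : U.Normal := hTn.map _ (MulAut.conjNormal g : MulAut N).surjective
      have hU1 : U ≠ ⊥ := fun h => hT1 <|
        (Subgroup.map_eq_bot_iff_of_injective _ (MulAut.conjNormal g : MulAut N).injective).1 h
      by_contra hUT
      have hinf : U ⊓ T = ⊥ := by
        by_contra h
        have hTU : T ≤ U := inf_eq_right.1 (hTmin _ inferInstance h inf_le_right)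
        refine hUT (Subgroup.eq_of_le_of_card_ge hTU (le_of_eq ?_)).ge
        exact Subgroup.card_map_of_injective (MulAut.conjNormal g : MulAut N).injective
      obtain ⟨⟨x, hxU⟩, hx⟩ := exists_prime_orderOf_dvd_card' p
        (hdvd p hp (fun K a b => (h2 K a b).1) U hUn hU1)
      obtain ⟨⟨y, hyT⟩, hy⟩ := exists_prime_orderOf_dvd_card' q
        (hdvd q hq (fun K a b => (h2 K a b).2) T hTn hT1)
      rw [Subgroup.orderOf_mk] at hx hy
      have hxy : Commute x y :=
        Subgroup.commute_of_normal_of_disjoint U T hUn hTn (disjoint_iff.2 hinf) x y hxU hyT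
      exact commute_pow_eq_one_of_not_dvd_orderOf hp hq hpq h1 (hxy.map N.subtype)
        ((orderOf_injective N.subtype N.subtype_injective x).trans hx)
        ((orderOf_injective N.subtype N.subtype_injective y).trans hy)
    have hTΓ : (T.map N.subtype).Normal := by
      refine ⟨?_⟩
      rintro _ ⟨t, ht, rfl⟩ g
      exact ⟨_, hconj g ⟨t, ht, rfl⟩, MulAut.conjNormal_apply g t⟩
    have h3 := hmin ⟨hTΓ, fun h => hT1 <|
      (Subgroup.map_eq_bot_iff_of_injective _ N.subtype_injective).1 h⟩ (Subgroup.map_subtype_le T)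
    rw [eq_top_iff]
    rintro ⟨n, hn⟩ -
    obtain ⟨t, ht, h⟩ := h3 hn
    rwa [show t = ⟨n, hn⟩ from Subtype.ext h] at ht
  refine ⟨N, hNn, ⟨fun L hLn => ?_⟩, fun hcomm => ?_, hpN, hqN⟩
  · rw [or_iff_not_imp_left]
    intro hL1
    obtain ⟨T, ⟨hTn, hT1, hTL⟩, hTmin⟩ := Set.Finite.exists_minimal
      (s := {K : Subgroup N | K.Normal ∧ K ≠ ⊥ ∧ K ≤ L}) (Set.toFinite _) ⟨L, hLn, hL1, le_rfl⟩
    have hT := hNc T hTn hT1 fun K hK hK1 hKT =>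
      le_antisymm hKT (hTmin ⟨hK, hK1, hKT.trans hTL⟩ hKT)
    exact top_le_iff.1 (hT ▸ hTL)
  · obtain ⟨x, hx⟩ := exists_prime_orderOf_dvd_card' p hpN
    obtain ⟨y, hy⟩ := exists_prime_orderOf_dvd_card' q hqN
    exact commute_pow_eq_one_of_not_dvd_orderOf hp hq hpq h1
      (x := (x : Γ)) (y := (y : Γ)) (congrArg Subtype.val (hcomm x y))
        ((orderOf_injective N.subtype N.subtype_injective x).trans hx)
        ((orderOf_injective N.subtype N.subtype_injective y).trans hy)

open scoped commutatorElement in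
/-- If the Sylow `p`-subgroups of a finite group are cyclic, a nonabelian simple normal subgroup of
order divisible by `p` has index prime to `p`. -/
theorem not_dvd_index_of_isCyclic_sylow {Γ : Type*} [Group Γ] [Finite Γ] {p : ℕ} (hp : p.Prime)
    (R : Sylow p Γ) [IsCyclic R] (N : Subgroup Γ) [N.Normal] [IsSimpleGroup N]
    (hnc : ¬ ∀ a b : N, a * b = b * a) (hpN : p ∣ Nat.card N) : ¬ p ∣ N.index := by
  have _ : Fact p.Prime := ⟨hp⟩
  have hperf : ⁅N, N⁆ = N := by
    rw [← Subgroup.map_subtype_commutator]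
    rcases IsSimpleGroup.eq_bot_or_eq_top_of_normal (commutator N) inferInstance with h | h
    · refine absurd (fun a b => ?_) hnc
      have h1 : ⁅a, b⁆ ∈ commutator N :=
        Subgroup.commutator_mem_commutator (Subgroup.mem_top a) (Subgroup.mem_top b)
      rw [h, Subgroup.mem_bot, commutatorElement_eq_one_iff_mul_comm] at h1
      exact h1
    · rw [h, ← MonoidHom.range_eq_map, N.range_subtype]
  set Y : Subgroup Γ := R ⊔ N
  have hY : ⁅Y, Y⁆ = N := by
    refine le_antisymm ?_ ?_
    · have h1 : Y.map (QuotientGroup.mk' N) = (R : Subgroup Γ).map (QuotientGroup.mk' N) := by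
        rw [Subgroup.map_sup, (Subgroup.map_eq_bot_iff _).2 (QuotientGroup.ker_mk' N).ge,
          sup_bot_eq]
      have h2 : ⁅(R : Subgroup Γ), (R : Subgroup Γ)⁆ = ⊥ := by
        rw [Subgroup.commutator_eq_bot_iff_le_centralizer]
        intro x hx y hy
        exact congrArg Subtype.val (mul_comm' (⟨y, hy⟩ : R) ⟨x, hx⟩)
      have h3 : ⁅Y, Y⁆.map (QuotientGroup.mk' N) = ⊥ := by
        rw [Subgroup.map_commutator, h1, ← Subgroup.map_commutator, h2, Subgroup.map_bot]
      rw [Subgroup.map_eq_bot_iff, QuotientGroup.ker_mk'] at h3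
      exact h3
    · calc N = ⁅N, N⁆ := hperf.symm
        _ ≤ _ := Subgroup.commutator_mono le_sup_right le_sup_right
  have hYmap : (commutator Y).map Y.subtype = N := by rw [Subgroup.map_subtype_commutator, hY]
  have hYsub : commutator Y = N.subgroupOf Y := by
    rw [← hYmap, Subgroup.subgroupOf, Subgroup.comap_map_eq_self_of_injective Y.subtype_injective]
  let R' : Sylow p Y := R.subtype le_sup_left
  have : IsCyclic R' :=
    isCyclic_of_surjective _ (Subgroup.subgroupOfEquivOfLe
      (le_sup_left : (R : Subgroup Γ) ≤ Y)).symm.surjective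
  have h1 := (Sylow.not_dvd_card_commutator_or_not_dvd_index_commutator R').resolve_left
    (not_not.2 (by
      rwa [← Subgroup.card_map_of_injective (K := commutator Y) Y.subtype_injective, hYmap]))
  rw [hYsub, ← Subgroup.relIndex, Subgroup.relIndex_sup_right] at h1
  have h2 : N.relIndex R = 1 := by
    obtain ⟨k, hk⟩ := R.2.exists_card_eq
    refine Nat.Coprime.eq_one_of_dvd ?_ (hk ▸ Subgroup.relIndex_dvd_card N R)
    exact Nat.Coprime.pow_right k ((Nat.Prime.coprime_iff_not_dvd hp).2 h1).symm
  exact fun h =>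
    R.not_dvd_index (h.trans (Subgroup.index_dvd_of_le (Subgroup.relIndex_eq_one.1 h2)))

theorem exists_normal_index_eq_of_isNilpotent {F : Type*} [Group F] [Finite F]
    [Group.IsNilpotent F] {p : ℕ} (hp : p.Prime) (hpF : p ∣ Nat.card F) :
    ∃ K : Subgroup F, K.Normal ∧ K.index = p := by
  have _ : Fact p.Prime := ⟨hp⟩
  obtain ⟨e⟩ := ((Group.isNilpotent_of_finite_tfae (G := F)).out 0 4 rfl rfl).1 ‹_›
  let P : Sylow p F := default
  let f₁ := Pi.evalMonoidHom
    (fun r : (Nat.card F).primeFactors => ∀ Q : Sylow r F, ((Q : Subgroup F) : Type _))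
    ⟨p, Nat.mem_primeFactors.2 ⟨hp, hpF, Nat.card_pos.ne'⟩⟩
  let f₂ := Pi.evalMonoidHom (fun Q : Sylow p F => ((Q : Subgroup F) : Type _)) P
  have hf₁ : Function.Surjective f₁ := Function.surjective_eval _
  have hf₂ : Function.Surjective f₂ := Function.surjective_eval _
  let f : F →* P := (f₂.comp f₁).comp e.symm.toMonoidHom
  have hf : Function.Surjective f := (hf₂.comp hf₁).comp e.symm.surjective
  obtain ⟨k, hk⟩ := P.2.exists_card_eq
  obtain ⟨k, rfl⟩ : ∃ j, k = j + 1 := by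
    refine Nat.exists_eq_succ_of_ne_zero fun h0 => ?_
    have h1 := P.dvd_card_of_dvd_card hpF
    have h2 : Nat.card P = p ^ k := hk
    rw [h2, h0, pow_zero] at h1
    exact hp.one_lt.ne' (Nat.dvd_one.1 h1)
  have hk' : Nat.card P = p ^ (k + 1) := hk
  obtain ⟨K, hK⟩ := Sylow.exists_subgroup_card_pow_prime p (G := P) (n := k)
    (hk' ▸ pow_dvd_pow p k.le_succ)
  have hi : K.index = p := by
    have h1 := K.card_mul_index
    rw [hK, hk', pow_succ] at h1
    exact Nat.eq_of_mul_eq_mul_left (pow_pos hp.pos k) h1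
  have hKn : K.Normal := by
    refine Subgroup.normal_of_index_eq_minFac_card ?_
    rw [hi, hk', hp.pow_minFac k.succ_ne_zero]
  exact ⟨K.comap f, hKn.comap f, by rw [Subgroup.index_comap_of_surjective K hf, hi]⟩

/-- A nilpotent normal subgroup of order divisible by `p` has a nontrivial elementary abelian
`p`-quotient by a normal subgroup of the whole group. -/
theorem exists_normal_elementary_quotient {G : Type*} [Group G] [Finite G] {F : Subgroup G}
    [F.Normal] [Group.IsNilpotent F] {p : ℕ} (hp : p.Prime) (hpF : p ∣ Nat.card F) :
    ∃ M : Subgroup G, M.Normal ∧ M ≤ F ∧ ¬ F ≤ M ∧ (∀ x ∈ F, x ^ p ∈ M) ∧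
      ∀ x ∈ F, ∀ y ∈ F, (x * y)⁻¹ * (y * x) ∈ M := by
  have _ : Fact p.Prime := ⟨hp⟩
  let 𝒦 : Set (Subgroup F) := {K | K.Normal ∧ K.index = p}
  have hc : (sInf 𝒦).Characteristic := by
    rw [Subgroup.characteristic_iff_le_comap]
    intro φ x hx
    refine Subgroup.mem_comap.2 (Subgroup.mem_sInf.2 fun K hK => ?_)
    exact Subgroup.mem_sInf.1 hx (K.comap φ.toMonoidHom)
      ⟨hK.1.comap _, by rw [Subgroup.index_comap_of_surjective K φ.surjective, hK.2]⟩
  have hquot : (∀ x y : F, (x * y)⁻¹ * (y * x) ∈ sInf 𝒦) ∧ ∀ x : F, x ^ p ∈ sInf 𝒦 := by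
    refine ⟨fun x y => Subgroup.mem_sInf.2 ?_, fun x => Subgroup.mem_sInf.2 ?_⟩ <;>
    · rintro K ⟨hKn, hKi⟩
      have hcard : Nat.card (F ⧸ K) = p := hKi
      have := isCyclic_of_prime_card hcard
      first
      | exact QuotientGroup.eq.1 (mul_comm' (x : F ⧸ K) (y : F ⧸ K))
      | rw [← QuotientGroup.eq_one_iff, QuotientGroup.mk_pow, ← hcard, pow_card_eq_one']
  refine ⟨(sInf 𝒦).map F.subtype, inferInstance, Subgroup.map_subtype_le _, fun hle => ?_,
    fun x hx => ⟨_, hquot.2 ⟨x, hx⟩, rfl⟩, fun x hx y hy => ⟨_, hquot.1 ⟨x, hx⟩ ⟨y, hy⟩, rfl⟩⟩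
  obtain ⟨K, hKn, hKi⟩ := exists_normal_index_eq_of_isNilpotent hp hpF
  have hK : K = ⊤ := by
    rw [eq_top_iff]
    rintro ⟨x, hx⟩ -
    obtain ⟨y, hy, h⟩ := hle hx
    rw [show (⟨x, hx⟩ : F) = y from Subtype.ext h.symm]
    exact Subgroup.mem_sInf.1 hy K ⟨hKn, hKi⟩
  rw [hK, Subgroup.index_top] at hKi
  exact hp.one_lt.ne hKi

/-- Nontrivial commuting elements of `p`-power and of `q`-power order lie in `F`. -/
def CommutingPrimaryElementsMem {G : Type*} [Group G] (p q : ℕ) (F : Subgroup G) : Prop :=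
  ∀ (x y : G) (a b : ℕ), Commute x y → x ^ p ^ a = 1 → y ^ q ^ b = 1 → x ≠ 1 → y ≠ 1 →
    x ∈ F ∧ y ∈ F

theorem CommutingPrimaryElementsMem.symm {G : Type*} [Group G] {p q : ℕ} {F : Subgroup G}
    (h : CommutingPrimaryElementsMem p q F) : CommutingPrimaryElementsMem q p F :=
  fun x y a b hxy hx hy hx1 hy1 => (h y x b a hxy.symm hy hx hy1 hx1).symm

theorem exists_orderOf_eq_pow_succ {G : Type*} [Group G] {p a : ℕ} (hp : p.Prime) {x : G}
    (hx : x ^ p ^ a = 1) (hx1 : x ≠ 1) : ∃ k, orderOf x = p ^ (k + 1) := by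
  obtain ⟨k, -, hk⟩ := (Nat.dvd_prime_pow hp).1 (orderOf_dvd_of_pow_eq_one hx)
  rcases k with - | k
  · exact absurd (orderOf_eq_one_iff.1 (hk.trans (pow_zero p))) hx1
  · exact ⟨k, hk⟩

theorem commutingPrimaryElementsMem_of_forall {G : Type*} [Group G] {p q : ℕ} (hp : p.Prime)
    (hq : q.Prime) (hpq : p ≠ q) {F : Subgroup G}
    (h : ∀ γ : G, p * q ∣ orderOf γ → (∀ r : ℕ, r.Prime → r ∣ orderOf γ → r = p ∨ r = q) → γ ∈ F) :
    CommutingPrimaryElementsMem p q F := by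
  intro x y a b hxy hx hy hx1 hy1
  obtain ⟨k, hk⟩ := exists_orderOf_eq_pow_succ hp hx hx1
  obtain ⟨l, hl⟩ := exists_orderOf_eq_pow_succ hq hy hy1
  have hcop : (orderOf x).Coprime (orderOf y) := by
    rw [hk, hl]; exact Nat.coprime_pow_primes _ _ hp hq hpq
  have hord := hxy.orderOf_mul_eq_mul_orderOf_of_coprime hcop
  have hF : x * y ∈ F := by
    refine h _ ?_ fun r hr hrd => ?_
    · rw [hord, hk, hl]
      exact mul_dvd_mul (dvd_pow_self p k.succ_ne_zero) (dvd_pow_self q l.succ_ne_zero)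
    · rw [hord, hk, hl, hr.dvd_mul] at hrd
      exact hrd.imp (fun h => (Nat.prime_dvd_prime_iff_eq hr hp).1 (hr.dvd_of_dvd_pow h))
        fun h => (Nat.prime_dvd_prime_iff_eq hr hq).1 (hr.dvd_of_dvd_pow h)
  have hxF : x ∈ F := by
    obtain ⟨m, hm⟩ := Nat.chineseRemainder hcop 1 0
    have h1 : (x * y) ^ m = x := by
      rw [hxy.mul_pow, orderOf_dvd_iff_pow_eq_one.1 ((Nat.modEq_zero_iff_dvd).1 hm.2), mul_one]
      conv_rhs => rw [← pow_one x]
      exact pow_eq_pow_iff_modEq.2 hm.1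
    exact h1 ▸ F.pow_mem hF m
  exact ⟨hxF, (F.mul_mem_cancel_left hxF).1 hF⟩

theorem exists_normal_isPGroup {G : Type*} [Group G] [Finite G] (F : Subgroup G)
    [F.Normal] [Group.IsNilpotent F] {p : ℕ} (hp : p.Prime) :
    ∃ P : Subgroup G, P.Normal ∧ IsPGroup p P ∧ ∀ x ∈ F, ∀ c : ℕ, x ^ p ^ c = 1 → x ∈ P := by
  have _ : Fact p.Prime := ⟨hp⟩
  let P : Sylow p F := default
  have hc : (P : Subgroup F).Characteristic := P.characteristic_of_normal inferInstance
  refine ⟨(P : Subgroup F).map F.subtype, inferInstance, P.2.map _, fun x hx c hxc => ?_⟩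
  have hz : IsPGroup p (Subgroup.zpowers (⟨x, hx⟩ : F)) := by
    have h1 : orderOf (⟨x, hx⟩ : F) ∣ p ^ c :=
      orderOf_dvd_of_pow_eq_one (Subtype.ext (by simpa using hxc))
    obtain ⟨k, -, hk⟩ := (Nat.dvd_prime_pow hp).1 h1
    exact IsPGroup.of_card (n := k) (by rw [Nat.card_zpowers, hk])
  obtain ⟨Q, hQ⟩ := hz.exists_le_sylow
  have _ := P.unique_of_normal inferInstance
  exact ⟨_, Subsingleton.elim Q P ▸ hQ (Subgroup.mem_zpowers _), rfl⟩

theorem mem_of_pow_mem_of_not_dvd {G : Type*} [Group G] {p k m : ℕ} (hp : p.Prime) {M : Subgroup G}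
    [M.Normal] {x : G} (hx : x ^ p ^ k ∈ M) (hm : ¬ p ∣ m) (hxm : x ^ m ∈ M) : x ∈ M := by
  rw [← QuotientGroup.eq_one_iff, QuotientGroup.mk_pow] at hx hxm
  rw [← QuotientGroup.eq_one_iff]
  by_contra h
  exact pow_ne_one_of_not_dvd hp h hx hm hxm

theorem mem_of_commutator_mem {G : Type*} [Group G] [Finite G] {p q : ℕ} (hp : p.Prime)
    (hq : q.Prime) (hpq : p ≠ q) {F M : Subgroup G} [F.Normal] [Group.IsNilpotent F] [M.Normal]
    (hsep : CommutingPrimaryElementsMem p q F) (hpow : ∀ x ∈ F, x ^ p ∈ M) {x y : G} (hy : y ∉ F)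
    {b : ℕ} (hyb : y ^ q ^ b = 1) (hx : x ∈ F) (hxy : y * x * y⁻¹ * x⁻¹ ∈ M) : x ∈ M := by
  have _ : Fact p.Prime := ⟨hp⟩
  by_contra hxM
  obtain ⟨P, hPn, hPp, hP⟩ := exists_normal_isPGroup F hp
  obtain ⟨m, c, hm, hmc⟩ := exists_pow_qpow_eq_one hp x
  have hx' : x ^ m ∉ M := fun h =>
    hxM (mem_of_pow_mem_of_not_dvd (k := 1) hp (by simpa using hpow x hx) hm h)
  have hxP : x ^ m ∈ P := hP _ (F.pow_mem hx m) c hmc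
  have hxyM : y * x ^ m * y⁻¹ * (x ^ m)⁻¹ ∈ M := by
    rw [← QuotientGroup.eq_one_iff] at hxy ⊢
    simp only [QuotientGroup.mk_mul, QuotientGroup.mk_inv, QuotientGroup.mk_pow] at hxy ⊢
    rw [mul_inv_eq_one] at hxy ⊢
    rw [← conj_pow, hxy]
  have hUcard : ¬ q ∣ Nat.card ↥(M ⊓ P) := by
    obtain ⟨k, hk⟩ := (hPp.to_le (inf_le_right : M ⊓ P ≤ P)).exists_card_eq
    rw [hk]
    exact fun h => hpq ((Nat.prime_dvd_prime_iff_eq hq hp).1 (hq.dvd_of_dvd_pow h)).symm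
  obtain ⟨u, hu, hcomm⟩ := exists_commute_mem_coset hq (M ⊓ P) hUcard hyb
    (fun u hu => (inferInstance : (M ⊓ P).Normal).conj_mem u hu y)
    ⟨hxyM, P.mul_mem (hPn.conj_mem _ hxP y) (P.inv_mem hxP)⟩
  have huP : u * x ^ m ∈ P := P.mul_mem hu.2 hxP
  obtain ⟨a, ha⟩ := hPp ⟨_, huP⟩
  refine hy (hsep (u * x ^ m) y a b hcomm.symm (by simpa using congrArg Subtype.val ha) hyb
    (fun h => hx' ?_) fun h => hy (h ▸ F.one_mem)).2
  rw [eq_inv_of_mul_eq_one_right h]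
  exact M.inv_mem hu.1

/-- A variant of `exists_normal_complement` relative to a normal subgroup `M` of `F`. -/
theorem exists_normal_relative_complement {G : Type*} [Group G] [Finite G] {p : ℕ} (hp : p.Prime)
    {F M N : Subgroup G} [F.Normal] [M.Normal] [N.Normal] (hMF : M ≤ F) (hFN : F ≤ N)
    (hpow : ∀ x ∈ F, x ^ p ∈ M) (hcomm : ∀ x ∈ F, ∀ y ∈ F, (x * y)⁻¹ * (y * x) ∈ M)
    (hgen : ∀ K : Subgroup G, K ⊔ F = ⊤ → K = ⊤) (hpN : ¬ p ∣ F.relIndex N) :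
    ∃ B : Subgroup G, B.Normal ∧ B ⊔ F = N ∧ B ⊓ F = M := by
  have _ : Fact p.Prime := ⟨hp⟩
  let f := QuotientGroup.mk' M
  have hf : Function.Surjective f := QuotientGroup.mk'_surjective M
  have hker : f.ker = M := QuotientGroup.ker_mk' M
  have hcm : ∀ K : Subgroup G, M ≤ K → (K.map f).comap f = K := fun K hK =>
    Subgroup.comap_map_eq_self (hker.trans_le hK)
  have hFn : (F.map f).Normal := ‹F.Normal›.map f hf
  have hNn : (N.map f).Normal := ‹N.Normal›.map f hf
  have hVp : IsPGroup p (F.map f) := by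
    rintro ⟨_, x, hx, rfl⟩
    refine ⟨1, Subtype.ext ?_⟩
    rw [pow_one]
    change f x ^ p = 1
    rw [← map_pow, ← MonoidHom.mem_ker, hker]
    exact hpow x hx
  obtain ⟨k, hk⟩ := hVp.exists_card_eq
  obtain ⟨B, hBn, hsup, hinf⟩ := exists_normal_complement (V := F.map f) (N := N.map f)
    (by
      rintro _ ⟨x, hx, rfl⟩ _ ⟨y, hy, rfl⟩
      exact QuotientGroup.eq.2 (hcomm x hx y hy))
    (Subgroup.map_mono hFN)
    (by
      rw [hk, ← Subgroup.relIndex_comap, hcm F hMF]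
      exact Nat.Coprime.pow_left k ((Nat.Prime.coprime_iff_not_dvd hp).2 hpN))
    (fun K hK => by
      have h1 : K.comap f = ⊤ := hgen _ (by
        rw [← hcm F hMF, Subgroup.comap_sup_eq _ _ _ hf, hK, Subgroup.comap_top])
      rw [← Subgroup.map_comap_eq_self_of_surjective hf K, h1,
        Subgroup.map_top_of_surjective f hf])
  refine ⟨B.comap f, hBn.comap f, ?_, ?_⟩
  · rw [← hcm F hMF, Subgroup.comap_sup_eq _ _ _ hf, hsup, hcm N (hMF.trans hFN)]
  · rw [← hcm F hMF, ← Subgroup.comap_inf, hinf, MonoidHom.comap_bot, hker]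

theorem exists_mem_qpow_eq_one_of_dvd_relIndex {G : Type*} [Group G] [Finite G] {q : ℕ}
    (hq : q.Prime) {F N : Subgroup G} [F.Normal] (h : q ∣ F.relIndex N) :
    ∃ y ∈ N, y ∉ F ∧ ∃ b : ℕ, y ^ q ^ b = 1 := by
  have _ : Fact q.Prime := ⟨hq⟩
  obtain ⟨z, hz⟩ := exists_prime_orderOf_dvd_card' (G := N ⧸ F.subgroupOf N) q h
  obtain ⟨⟨n, hn⟩, rfl⟩ := QuotientGroup.mk_surjective z
  obtain ⟨m, b, hm, hb⟩ := exists_pow_qpow_eq_one hq n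
  have hnF : n ^ q ^ 1 ∈ F := by
    have h1 := pow_orderOf_eq_one ((⟨n, hn⟩ : N) : N ⧸ F.subgroupOf N)
    rw [hz, ← QuotientGroup.mk_pow, QuotientGroup.eq_one_iff] at h1
    rw [pow_one]
    exact h1
  refine ⟨n ^ m, N.pow_mem hn m, fun hmem => ?_, b, hb⟩
  have h2 : ((⟨n, hn⟩ : N) : N ⧸ F.subgroupOf N) = 1 :=
    (QuotientGroup.eq_one_iff _).2 (mem_of_pow_mem_of_not_dvd hq hnF hm hmem)
  rw [h2, orderOf_one] at hz
  exact hq.one_lt.ne hz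

/-- `A / B` is an elementary abelian `p`-group on which nontrivial elements of `q`-power order of
`G / A` act fixed-point-freely. -/
structure IsFixedPointFreeSection {G : Type*} [Group G] (p q : ℕ) (A B : Subgroup G) : Prop where
  le : B ≤ A
  pow_mem : ∀ x ∈ A, x ^ p ∈ B
  comm_mem : ∀ x ∈ A, ∀ y ∈ A, (x * y)⁻¹ * (y * x) ∈ B
  fixed_mem : ∀ y ∉ A, ∀ b : ℕ, y ^ q ^ b ∈ A → ∀ x ∈ A, (x * y)⁻¹ * (y * x) ∈ B → x ∈ B

namespace IsFixedPointFreeSection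

variable {G : Type*} [Group G] {p q : ℕ} {A B : Subgroup G}

theorem subgroupOf (h : IsFixedPointFreeSection p q A B) (H : Subgroup G) :
    IsFixedPointFreeSection p q (A.subgroupOf H) (B.subgroupOf H) where
  le := Subgroup.comap_mono h.le
  pow_mem x hx := h.pow_mem x hx
  comm_mem x hx y hy := h.comm_mem x hx y hy
  fixed_mem y hy b hyb x hx hxy := h.fixed_mem y hy b hyb x hx hxy

variable [A.Normal] [B.Normal]

/-- The projection `G / B → G / A`. -/
def proj (h : IsFixedPointFreeSection p q A B) : G ⧸ B →* G ⧸ A :=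
  QuotientGroup.map B A (MonoidHom.id G) h.le

theorem proj_mk (h : IsFixedPointFreeSection p q A B) (x : G) : h.proj x = (x : G ⧸ A) := rfl

theorem proj_surjective (h : IsFixedPointFreeSection p q A B) : Function.Surjective h.proj := by
  intro x
  obtain ⟨x, rfl⟩ := QuotientGroup.mk_surjective x
  exact ⟨x, rfl⟩

theorem mk_mem_ker (h : IsFixedPointFreeSection p q A B) {x : G} :
    (x : G ⧸ B) ∈ h.proj.ker ↔ x ∈ A := by
  rw [MonoidHom.mem_ker, proj_mk, QuotientGroup.eq_one_iff]

theorem ker_comm (h : IsFixedPointFreeSection p q A B) :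
    ∀ v ∈ h.proj.ker, ∀ w ∈ h.proj.ker, v * w = w * v := by
  intro v hv w hw
  obtain ⟨x, rfl⟩ := QuotientGroup.mk_surjective v
  obtain ⟨y, rfl⟩ := QuotientGroup.mk_surjective w
  exact QuotientGroup.eq.2 (h.comm_mem x (h.mk_mem_ker.1 hv) y (h.mk_mem_ker.1 hw))

theorem pow_eq_one (h : IsFixedPointFreeSection p q A B) : ∀ v ∈ h.proj.ker, v ^ p = 1 := by
  intro v hv
  obtain ⟨x, rfl⟩ := QuotientGroup.mk_surjective v
  rw [← QuotientGroup.mk_pow, QuotientGroup.eq_one_iff]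
  exact h.pow_mem x (h.mk_mem_ker.1 hv)

theorem ker_isPGroup (h : IsFixedPointFreeSection p q A B) : IsPGroup p h.proj.ker :=
  fun v => ⟨1, Subtype.ext (by rw [pow_one]; exact h.pow_eq_one v v.2)⟩

theorem eq_one_of_commute (h : IsFixedPointFreeSection p q A B) {y : G ⧸ B} (hy : h.proj y ≠ 1)
    (hyq : ∃ b : ℕ, h.proj y ^ q ^ b = 1) {v : G ⧸ B} (hv : v ∈ h.proj.ker) (hyv : y * v = v * y) :
    v = 1 := by
  obtain ⟨x, rfl⟩ := QuotientGroup.mk_surjective v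
  obtain ⟨y, rfl⟩ := QuotientGroup.mk_surjective y
  obtain ⟨b, hb⟩ := hyq
  rw [proj_mk] at hy hb
  rw [← QuotientGroup.mk_pow, QuotientGroup.eq_one_iff] at hb
  rw [QuotientGroup.eq_one_iff]
  exact h.fixed_mem y (fun hA => hy ((QuotientGroup.eq_one_iff y).2 hA)) b hb x
    (h.mk_mem_ker.1 hv) (QuotientGroup.eq.1 hyv.symm)

/-- The Sylow subgroups acting fixed-point-freely on a section are cyclic. -/
theorem isCyclic_sylow [Finite G] (h : IsFixedPointFreeSection p q A B) (hp : p.Prime)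
    (hq : q.Prime) (hpq : p ≠ q) (hqodd : Odd q) (hAB : ¬ A ≤ B) (R : Sylow q (G ⧸ A)) :
    IsCyclic R := by
  obtain ⟨c, hc⟩ := exists_conj_action h.proj h.proj_surjective h.ker_comm
  let _ : CommGroup h.proj.ker :=
    { (inferInstance : Group h.proj.ker) with
      mul_comm := fun a b => Subtype.ext (h.ker_comm a a.2 b b.2) }
  have : Nontrivial h.proj.ker := by
    obtain ⟨x, hxA, hxB⟩ := SetLike.not_le_iff_exists.1 hAB
    exact ⟨⟨x, h.mk_mem_ker.2 hxA⟩, 1, fun h1 =>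
      hxB ((QuotientGroup.eq_one_iff x).1 (congrArg Subtype.val h1))⟩
  refine IsPGroup.isCyclic_of_fixedPointFree hq hqodd R.2 (c.comp (R : Subgroup (G ⧸ A)).subtype)
    (fun r hr v hv => ?_) fun v hv => ?_
  · obtain ⟨y, hy⟩ := h.proj_surjective r
    obtain ⟨b, hb⟩ := R.2 r
    refine Subtype.ext (h.eq_one_of_commute (y := y) (fun h1 => hr (Subtype.ext (hy.symm.trans h1)))
      ⟨b, by rw [hy]; exact congrArg Subtype.val hb⟩ v.2 ?_)
    have h1 := hc y v
    rw [hy] at h1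
    have h2 : (v : G ⧸ B) = y * v * y⁻¹ := h1 ▸ (congrArg Subtype.val hv).symm
    exact (eq_mul_inv_iff_mul_eq.1 h2).symm
  · have h1 : v ^ p = 1 := Subtype.ext (h.pow_eq_one v v.2)
    rw [← orderOf_eq_one_iff]
    exact Nat.eq_one_of_dvd_coprimes ((Nat.coprime_primes hp hq).2 hpq)
      (orderOf_dvd_of_pow_eq_one h1) (orderOf_dvd_of_pow_eq_one hv)

/-- A variant of `exists_complement_of_coprime_index` relative to the normal subgroup `B`. -/
theorem exists_relative_complement [Finite G] (h : IsFixedPointFreeSection p q A B) (hp : p.Prime)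
    {H L : Subgroup G} (hpH : ¬ p ∣ H.index) (hsup : L ⊔ A = H) (hinf : L ⊓ A = B) :
    ∃ L' : Subgroup G, L' ⊔ A = ⊤ ∧ L' ⊓ A = B := by
  have _ : Fact p.Prime := ⟨hp⟩
  let f := QuotientGroup.mk' B
  have hf : Function.Surjective f := QuotientGroup.mk'_surjective B
  have hker : f.ker = B := QuotientGroup.ker_mk' B
  have hcm : ∀ K : Subgroup G, B ≤ K → (K.map f).comap f = K := fun K hK =>
    Subgroup.comap_map_eq_self (hker.trans_le hK)
  have hA : h.proj.ker = A.map f := by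
    rw [← Subgroup.map_comap_eq_self_of_surjective hf h.proj.ker]
    congr 1
    ext x
    exact h.mk_mem_ker
  have hBL : B ≤ L := hinf ▸ inf_le_left
  obtain ⟨k, hk⟩ := h.ker_isPGroup.exists_card_eq
  obtain ⟨L', hsup', hinf'⟩ := exists_complement_of_coprime_index (V := h.proj.ker)
    (H := H.map f) (L := L.map f) h.ker_comm
    (by
      rw [hk, ← Subgroup.index_comap_of_surjective _ hf, hcm H (hsup ▸ hBL.trans le_sup_left)]
      exact Nat.Coprime.pow_left k ((Nat.Prime.coprime_iff_not_dvd hp).2 hpH))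
    (by rw [hA, ← Subgroup.map_sup, hsup])
    (by
      apply Subgroup.comap_injective hf
      rw [hA, Subgroup.comap_inf, hcm L hBL, hcm A h.le, hinf, MonoidHom.comap_bot, hker])
  rw [hA] at hsup' hinf'
  refine ⟨L'.comap f, ?_, ?_⟩
  · rw [← hcm A h.le, Subgroup.comap_sup_eq _ _ _ hf, hsup', Subgroup.comap_top]
  · rw [← hcm A h.le, ← Subgroup.comap_inf, hinf', MonoidHom.comap_bot, hker]

end IsFixedPointFreeSection

/-- If `A / B` is nonsplit in `G`, then a simple subgroup of `G / A` of index prime to `p` has a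
module as in `HasFrattiniModule`. -/
theorem hasFrattiniModule_of_fixedPointFreeSection {G : Type} [Group G] [Finite G] {p q : ℕ}
    (hp : p.Prime) (hq : q.Prime) (hpq : p ≠ q) {A B : Subgroup G} [A.Normal] [B.Normal]
    (h : IsFixedPointFreeSection p q A B)
    (hns : ∀ L : Subgroup G, L ⊔ A = ⊤ → L ⊓ A ≠ B) {H : Subgroup G} (hAH : A ≤ H)
    (hpH : ¬ p ∣ H.index) [IsSimpleGroup (H ⧸ A.subgroupOf H)]
    (hqS : q ∣ Nat.card (H ⧸ A.subgroupOf H)) : HasFrattiniModule p q (H ⧸ A.subgroupOf H) := by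
  have hH := h.subgroupOf H
  refine hasFrattiniModule_of_nonsplit hp hq hpq hH.proj hH.proj_surjective hqS hH.ker_comm
    hH.ker_isPGroup (fun L hsup hinf => ?_) fun y hy hyq v hv => hH.eq_one_of_commute hy hyq hv
  let f := QuotientGroup.mk' (B.subgroupOf H)
  have hf : Function.Surjective f := QuotientGroup.mk'_surjective _
  have hker : hH.proj.ker.comap f = A.subgroupOf H := by
    ext x
    exact hH.mk_mem_ker
  have hA : (A.subgroupOf H).map H.subtype = A := by
    rw [Subgroup.subgroupOf_map_subtype, inf_eq_left.2 hAH]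
  obtain ⟨L', hsup', hinf'⟩ := h.exists_relative_complement hp (L := (L.comap f).map H.subtype) hpH
    (by
      conv_lhs => rw [← hA]
      rw [← Subgroup.map_sup, ← hker, Subgroup.comap_sup_eq _ _ _ hf, hsup, Subgroup.comap_top,
        ← MonoidHom.range_eq_map, H.range_subtype])
    (by
      conv_lhs => rw [← hA]
      rw [← Subgroup.map_inf _ _ _ H.subtype_injective, ← hker, ← Subgroup.comap_inf, hinf,
        MonoidHom.comap_bot, QuotientGroup.ker_mk', Subgroup.subgroupOf_map_subtype,
        inf_eq_left.2 (h.le.trans hAH)])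
  exact hns L' hsup' hinf'

theorem exists_eq_mul_of_mem {G : Type*} [Group G] {B F N : Subgroup G} [F.Normal] (h : B ⊔ F = N)
    {x : G} (hx : x ∈ N) : ∃ b ∈ B, ∃ f ∈ F, x = b * f := by
  obtain ⟨b, hb, f, hf, rfl⟩ := Subgroup.mem_sup_of_normal_right.1 (h ▸ hx : x ∈ B ⊔ F)
  exact ⟨b, hb, f, hf, rfl⟩

/-- If `F` consists of nongenerators of `G` and `p` does not divide `|N / F|`, then neither does
`q`. -/
theorem not_dvd_relIndex_of_not_dvd {G : Type*} [Group G] [Finite G] {p q : ℕ} (hp : p.Prime)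
    (hq : q.Prime) (hpq : p ≠ q) {F N : Subgroup G} [F.Normal] [Group.IsNilpotent F] [N.Normal]
    (hsep : CommutingPrimaryElementsMem p q F) (hgen : ∀ K : Subgroup G, K ⊔ F = ⊤ → K = ⊤)
    (hpF : p ∣ Nat.card F) (hFN : F ≤ N) (hpN : ¬ p ∣ F.relIndex N) : ¬ q ∣ F.relIndex N := by
  intro hqN
  obtain ⟨M, hM, hMF, hFM, hpow, hcomm⟩ := exists_normal_elementary_quotient (F := F) hp hpF
  obtain ⟨B, hB, hsup, hinf⟩ :=
    exists_normal_relative_complement hp hMF hFN hpow hcomm hgen hpN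
  obtain ⟨y, hyN, hyF, e, hye⟩ := exists_mem_qpow_eq_one_of_dvd_relIndex hq hqN
  obtain ⟨b, hb, f, hf, rfl⟩ := exists_eq_mul_of_mem hsup hyN
  refine hFM fun x hx => mem_of_commutator_mem hp hq hpq hsep hpow hyF hye hx ?_
  have hx' : f * x * f⁻¹ ∈ F := F.mul_mem (F.mul_mem hf hx) (F.inv_mem hf)
  have h1 : b * (f * x * f⁻¹) * b⁻¹ * (f * x * f⁻¹)⁻¹ ∈ M := by
    rw [← hinf]
    refine ⟨?_, F.mul_mem (‹F.Normal›.conj_mem _ hx' b) (F.inv_mem hx')⟩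
    have h2 := B.mul_mem hb (hB.conj_mem _ (B.inv_mem hb) (f * x * f⁻¹))
    have h3 : b * (f * x * f⁻¹) * b⁻¹ * (f * x * f⁻¹)⁻¹ =
      b * (f * x * f⁻¹ * b⁻¹ * (f * x * f⁻¹)⁻¹) := by group
    exact h3 ▸ h2
  have h2 : f * x * f⁻¹ * x⁻¹ ∈ M := by
    have h3 : (f : G ⧸ M) * x = x * f := QuotientGroup.eq.2 (hcomm f hf x hx)
    rw [← QuotientGroup.eq_one_iff]
    simp only [QuotientGroup.mk_mul, QuotientGroup.mk_inv]
    rw [h3, mul_inv_cancel_right, mul_inv_cancel]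
  have h3 := M.mul_mem h1 h2
  have h4 : b * f * x * (b * f)⁻¹ * x⁻¹ =
    b * (f * x * f⁻¹) * b⁻¹ * (f * x * f⁻¹)⁻¹ * (f * x * f⁻¹ * x⁻¹) := by group
  exact h4 ▸ h3

/-- If `F` consists of nongenerators of `G` and `p` does not divide `|A / F|`, then `G` has a
nonsplit section `A / B` on which elements of `q`-power order act fixed-point-freely. -/
theorem exists_fixedPointFreeSection {G : Type*} [Group G] [Finite G] {p q : ℕ} (hp : p.Prime)
    (hq : q.Prime) (hpq : p ≠ q) {F A : Subgroup G} [F.Normal] [Group.IsNilpotent F] [A.Normal]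
    (hsep : CommutingPrimaryElementsMem p q F) (hgen : ∀ K : Subgroup G, K ⊔ F = ⊤ → K = ⊤)
    (hpF : p ∣ Nat.card F) (hFA : F ≤ A) (hpA : ¬ p ∣ F.relIndex A) :
    ∃ B : Subgroup G, B.Normal ∧ IsFixedPointFreeSection p q A B ∧ ¬ A ≤ B ∧
      ∀ L : Subgroup G, L ⊔ A = ⊤ → L ⊓ A ≠ B := by
  obtain ⟨M, hM, hMF, hFM, hpow, hcomm⟩ := exists_normal_elementary_quotient (F := F) hp hpF
  obtain ⟨B, hB, hsup, hinf⟩ :=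
    exists_normal_relative_complement hp hMF hFA hpow hcomm hgen hpA
  have hBA : B ≤ A := hsup ▸ le_sup_left
  have hMB : M ≤ B := hinf ▸ inf_le_left
  have hAB : ¬ A ≤ B := fun h => hFM (hinf ▸ le_inf (hFA.trans h) le_rfl)
  have hmk : ∀ x ∈ A, ∃ f ∈ F, (x : G ⧸ B) = f := by
    intro x hx
    obtain ⟨b, hb, f, hf, rfl⟩ := exists_eq_mul_of_mem hsup hx
    exact ⟨f, hf, by rw [QuotientGroup.mk_mul, (QuotientGroup.eq_one_iff b).2 hb, one_mul]⟩
  refine ⟨B, hB, ⟨hBA, fun x hx => ?_, fun x hx y hy => ?_, fun y hy b hyb x hx hxy => ?_⟩, hAB,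
    fun L hL hLB => hAB ?_⟩
  · obtain ⟨f, hf, h⟩ := hmk x hx
    rw [← QuotientGroup.eq_one_iff, QuotientGroup.mk_pow, h, ← QuotientGroup.mk_pow,
      QuotientGroup.eq_one_iff]
    exact hMB (hpow f hf)
  · obtain ⟨f, hf, h⟩ := hmk x hx
    obtain ⟨f', hf', h'⟩ := hmk y hy
    rw [← QuotientGroup.eq, QuotientGroup.mk_mul, QuotientGroup.mk_mul, h, h',
      ← QuotientGroup.mk_mul, ← QuotientGroup.mk_mul, QuotientGroup.eq]
    exact hMB (hcomm f hf f' hf')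
  · obtain ⟨f, hf, h⟩ := hmk x hx
    obtain ⟨m, c, hm, hmc⟩ := exists_pow_qpow_eq_one hq y
    have hyA : y ^ m ∉ A := fun hA => hy (mem_of_pow_mem_of_not_dvd hq hyb hm hA)
    rw [← QuotientGroup.eq, QuotientGroup.mk_mul, QuotientGroup.mk_mul, h] at hxy
    have hfy : y ^ m * f * (y ^ m)⁻¹ * f⁻¹ ∈ M := by
      rw [← hinf]
      refine ⟨(QuotientGroup.eq_one_iff _).1 ?_,
        F.mul_mem (‹F.Normal›.conj_mem f hf _) (F.inv_mem hf)⟩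
      simp only [QuotientGroup.mk_mul, QuotientGroup.mk_inv, QuotientGroup.mk_pow]
      have h1 : Commute (y : G ⧸ B) f := hxy.symm
      rw [(h1.pow_left m).eq, mul_inv_cancel_right, mul_inv_cancel]
    have hfM := mem_of_commutator_mem hp hq hpq hsep hpow (fun hF => hyA (hFA hF)) hmc hf hfy
    rw [← QuotientGroup.eq_one_iff, h, QuotientGroup.eq_one_iff]
    exact hMB hfM
  · have hBL : B ≤ L := hLB ▸ inf_le_left
    have h1 : L = ⊤ := hgen L (by
      rw [← hL, ← hsup, ← sup_assoc, sup_eq_left.2 hBL])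
    rw [← hLB, h1, top_inf_eq]

theorem not_mul_dvd_orderOf_quotient {G : Type*} [Group G] [Finite G] {p q : ℕ} (hp : p.Prime)
    (hq : q.Prime) {F A : Subgroup G} [A.Normal] (hsep : CommutingPrimaryElementsMem p q F)
    (hFA : F ≤ A) (z : G ⧸ A) : ¬ p * q ∣ orderOf z := by
  obtain ⟨g, rfl⟩ := QuotientGroup.mk_surjective z
  intro h
  have hne : ∀ r m : ℕ, r ∣ orderOf (g : G ⧸ A) → ¬ r ∣ m → g ^ m ∉ A := by
    intro r m hr hm hA
    rw [← QuotientGroup.eq_one_iff, QuotientGroup.mk_pow] at hA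
    exact hm (hr.trans (orderOf_dvd_of_pow_eq_one hA))
  obtain ⟨m, a, hm, ha⟩ := exists_pow_qpow_eq_one hp g
  obtain ⟨n, b, hn, hb⟩ := exists_pow_qpow_eq_one hq g
  have h1 := hne p m ((dvd_mul_right p q).trans h) hm
  have h2 := hne q n ((dvd_mul_left q p).trans h) hn
  exact h1 (hFA (hsep _ _ a b (Commute.pow_pow_self g m n) ha hb
    (fun h => h1 (h ▸ A.one_mem)) fun h => h2 (h ▸ A.one_mem)).1)

theorem dvd_card_of_orderOf_dvd {G : Type*} [Group G] [Finite G] {p q : ℕ} (hp : p.Prime)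
    (hq : q.Prime) {F : Subgroup G} {g : G} (hg : p * q ∣ orderOf g)
    (h : ∀ γ : G, p * q ∣ orderOf γ → (∀ r : ℕ, r.Prime → r ∣ orderOf γ → r = p ∨ r = q) → γ ∈ F) :
    p * q ∣ Nat.card F := by
  obtain ⟨m, hm⟩ := hg
  have hm0 : m ≠ 0 := by
    rintro rfl
    exact (orderOf_pos g).ne' (by simpa using hm)
  have hord : orderOf (g ^ m) = p * q := by
    rw [orderOf_pow_of_dvd hm0 ⟨p * q, by rw [hm, mul_comm]⟩, hm,
      Nat.mul_div_cancel _ (Nat.pos_of_ne_zero hm0)]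
  have hF : g ^ m ∈ F := h _ hord.symm.dvd fun r hr hrd => by
    rw [hord, hr.dvd_mul] at hrd
    exact hrd.imp (Nat.prime_dvd_prime_iff_eq hr hp).1 (Nat.prime_dvd_prime_iff_eq hr hq).1
  rw [← hord, ← Subgroup.orderOf_mk _ hF]
  exact orderOf_dvd_natCard _

theorem isSubnormal_of_normal {G : Type*} [Group G] {H : Subgroup G} (hH : H.Normal) :
    IsSubnormal H :=
  ⟨1, fun i => if i = 0 then H else ⊤, by simp, by simp, fun i hi => by
    obtain rfl : i = 0 := by omega
    simp only [if_true, zero_add, one_ne_zero, if_false]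
    exact ⟨le_top, inferInstance⟩⟩

theorem dvd_card_of_maximal {G : Type*} [Group G] [Finite G] {r : ℕ} (hr : r.Prime)
    {F A : Subgroup G} [A.Normal] (hFA : F ≤ A) (hrA : ¬ r ∣ F.relIndex A)
    (hmax : ∀ N : Subgroup G, N.Normal → A ≤ N → ¬ r ∣ F.relIndex N → N ≤ A)
    {N : Subgroup (G ⧸ A)} (hN : N.Normal) (hne : N ≠ ⊥) : r ∣ Nat.card N := by
  by_contra hrN
  have hs := QuotientGroup.mk'_surjective A
  have hAN : A ≤ N.comap (QuotientGroup.mk' A) := fun x hx => by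
    rw [Subgroup.mem_comap, QuotientGroup.mk'_apply, (QuotientGroup.eq_one_iff x).2 hx]
    exact N.one_mem
  have hcard : A.relIndex (N.comap (QuotientGroup.mk' A)) = Nat.card N := by
    have h := Subgroup.relIndex_ker (N.comap (QuotientGroup.mk' A)) (QuotientGroup.mk' A)
    rwa [QuotientGroup.ker_mk', Subgroup.map_comap_eq_self_of_surjective hs] at h
  have h := hmax _ (hN.comap _) hAN (by
    rw [← Subgroup.relIndex_mul_relIndex _ _ _ hFA hAN, hcard, hr.dvd_mul]
    exact not_or.2 ⟨hrA, hrN⟩)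
  refine hne ((Subgroup.eq_bot_iff_forall N).2 fun z hz => ?_)
  obtain ⟨x, rfl⟩ := QuotientGroup.mk_surjective z
  exact (QuotientGroup.eq_one_iff x).2 (h hz)

/-- The third isomorphism theorem for the preimage of a subgroup of a quotient. -/
theorem nonempty_quotient_comap_mulEquiv {G : Type*} [Group G] (A : Subgroup G) [A.Normal]
    (N : Subgroup (G ⧸ A)) :
    Nonempty ((N.comap (QuotientGroup.mk' A) ⧸
      A.subgroupOf (N.comap (QuotientGroup.mk' A))) ≃* N) := by
  let f := (QuotientGroup.mk' A).subgroupComap N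
  have hf : Function.Surjective f :=
    (QuotientGroup.mk' A).subgroupComap_surjective_of_surjective N
      (QuotientGroup.mk'_surjective A)
  have hker : A.subgroupOf (N.comap (QuotientGroup.mk' A)) = f.ker := by
    ext x
    rw [Subgroup.mem_subgroupOf, MonoidHom.mem_ker, ← QuotientGroup.eq_one_iff]
    exact (Subtype.ext_iff (a1 := f x) (a2 := 1)).symm
  exact ⟨(QuotientGroup.quotientMulEquivOfEq hker).trans
    (QuotientGroup.quotientKerEquivOfSurjective f hf)⟩

/-- Let `p, q` be distinct odd primes and `G` a finite group containing an element of
order divisible by `p·q`.  If no composition factor of `G` (i.e. no nonabelian simple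
quotient `H/N` with `H` subnormal in `G` and `N ⊴ H`) admits a `(p,q)`-Frattini triple,
then there exists `γ ∈ G \ Frat(G)` whose order is divisible by `p·q` and by no prime
other than `p` and `q`, i.e. `Ω**_{p,q}(G) ≠ ∅`. -/
theorem omega_star_star_nonempty_of_no_bad_composition_factor
    (G : Type) [Group G] [Finite G] (p q : ℕ)
    (hp : p.Prime) (hq : q.Prime) (hpodd : Odd p) (hqodd : Odd q) (hpq : p ≠ q)
    (g : G) (hg : p * q ∣ orderOf g)
    (hcf : ∀ H : Subgroup G, IsSubnormal H → ∀ (N : Subgroup ↥H) [N.Normal],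
      IsSimpleGroup (↥H ⧸ N) → (¬ ∀ a b : ↥H ⧸ N, a * b = b * a) →
      ¬ AdmitsFrattiniTriple p q (↥H ⧸ N)) :
    ∃ γ : G, γ ∉ frattini G ∧ p * q ∣ orderOf γ ∧
      ∀ r : ℕ, r.Prime → r ∣ orderOf γ → r = p ∨ r = q := by
  by_contra hno
  have hno' : ∀ γ : G, p * q ∣ orderOf γ →
      (∀ r : ℕ, r.Prime → r ∣ orderOf γ → r = p ∨ r = q) → γ ∈ frattini G :=
    fun γ h1 h2 => by_contra fun h3 => hno ⟨γ, h3, h1, h2⟩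
  have : Group.IsNilpotent (frattini G) := frattini_nilpotent
  have hgen : ∀ K : Subgroup G, K ⊔ frattini G = ⊤ → K = ⊤ := fun K => frattini_nongenerating
  have hsep := commutingPrimaryElementsMem_of_forall hp hq hpq hno'
  have hF := dvd_card_of_orderOf_dvd hp hq hg hno'
  have hpF := (dvd_mul_right p q).trans hF
  have hqF := (dvd_mul_left q p).trans hF
  obtain ⟨A, ⟨hA, hFA, hpA⟩, hmax⟩ := Set.Finite.exists_maximal
    (s := {A : Subgroup G | A.Normal ∧ frattini G ≤ A ∧ ¬ p ∣ (frattini G).relIndex A})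
    (Set.toFinite _)
    ⟨frattini G, inferInstance, le_rfl, by rw [Subgroup.relIndex_self]; exact hp.not_dvd_one⟩
  have hmaxp : ∀ N : Subgroup G, N.Normal → A ≤ N → ¬ p ∣ (frattini G).relIndex N → N ≤ A :=
    fun N hN hAN h => hmax ⟨hN, hFA.trans hAN, h⟩ hAN
  have hqA := not_dvd_relIndex_of_not_dvd hp hq hpq hsep hgen hpF hFA hpA
  have hmaxq : ∀ N : Subgroup G, N.Normal → A ≤ N → ¬ q ∣ (frattini G).relIndex N → N ≤ A :=
    fun N hN hAN h => hmaxp N hN hAN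
      (not_dvd_relIndex_of_not_dvd hq hp hpq.symm hsep.symm hgen hqF (hFA.trans hAN) h)
  obtain ⟨B, hB, hAB, hABne, hBns⟩ :=
    exists_fixedPointFreeSection hp hq hpq hsep hgen hpF hFA hpA
  obtain ⟨C, hC, hAC, hACne, hCns⟩ :=
    exists_fixedPointFreeSection hq hp hpq.symm hsep.symm hgen hqF hFA hqA
  have hord : ∀ z : G ⧸ A, ¬ p * q ∣ orderOf z := not_mul_dvd_orderOf_quotient hp hq hsep hFA
  have : Nontrivial (G ⧸ A) := by
    refine QuotientGroup.nontrivial_iff.2 fun hA => hBns B ?_ ?_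
    · rw [hA, sup_top_eq]
    · rw [hA, inf_top_eq]
  obtain ⟨N, hN, hNs, hNc, hpN, hqN⟩ := exists_normal_isSimpleGroup hp hq hpq hord fun N hN hne =>
    ⟨dvd_card_of_maximal hp hFA hpA hmaxp hN hne, dvd_card_of_maximal hq hFA hqA hmaxq hN hne⟩
  have : Fact p.Prime := ⟨hp⟩
  have : Fact q.Prime := ⟨hq⟩
  obtain ⟨P⟩ : Nonempty (Sylow p (G ⧸ A)) := inferInstance
  obtain ⟨Q⟩ : Nonempty (Sylow q (G ⧸ A)) := inferInstance
  have := hAC.isCyclic_sylow hq hp hpq.symm hpodd hACne P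
  have := hAB.isCyclic_sylow hp hq hpq hqodd hABne Q
  have hpi := not_dvd_index_of_isCyclic_sylow hp P N hNc hpN
  have hqi := not_dvd_index_of_isCyclic_sylow hq Q N hNc hqN
  obtain ⟨e⟩ := nonempty_quotient_comap_mulEquiv A N
  have hidx := Subgroup.index_comap_of_surjective N (QuotientGroup.mk'_surjective A)
  have hAH : A ≤ N.comap (QuotientGroup.mk' A) := fun x hx => by
    rw [Subgroup.mem_comap, QuotientGroup.mk'_apply, (QuotientGroup.eq_one_iff x).2 hx]
    exact N.one_mem
  have hS : IsSimpleGroup (N.comap (QuotientGroup.mk' A) ⧸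
    A.subgroupOf (N.comap (QuotientGroup.mk' A))) := e.isSimpleGroup
  refine hcf _ (isSubnormal_of_normal (hN.comap (QuotientGroup.mk' A))) _ hS
    (fun h => hNc fun a b => ?_)
    (admitsFrattiniTriple_of_hasFrattiniModule
      (hasFrattiniModule_of_fixedPointFreeSection hp hq hpq hAB hBns hAH (hidx ▸ hpi)
        (Nat.card_congr e.toEquiv ▸ hqN))
      (hasFrattiniModule_of_fixedPointFreeSection hq hp hpq.symm hAC hCns hAH (hidx ▸ hqi)
        (Nat.card_congr e.toEquiv ▸ hpN)) fun s => ?_)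
  · exact e.symm.injective (by rw [map_mul, map_mul]; exact h _ _)
  · rw [← e.orderOf_eq s, ← Subgroup.orderOf_coe]
    exact hord _
end

section
/- Let p and q be distinct primes and let S be a finite nonabelian simple group admitting a (p,q)-Frattini triple (S, P, Q). Then the Sylow p-subgroups and the Sylow q-subgroups of S are cyclic. -/
/-- If `y * x = x * y * c` with `c` commuting with `x` and `y`, then
`(x * y) ^ n = x ^ n * y ^ n * c ^ n.choose 2`. -/
theorem mul_pow_of_mul_eq_mul_mul {G : Type*} [Monoid G] {x y c : G} (hx : Commute c x)
    (hy : Commute c y) (h : y * x = x * y * c) (n : ℕ) :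
    y ^ n * x = x * y ^ n * c ^ n ∧ (x * y) ^ n = x ^ n * y ^ n * c ^ n.choose 2 := by
  have key (n : ℕ) : y ^ n * x = x * y ^ n * c ^ n := by
    induction n with
    | zero => simp
    | succ n ih =>
      calc y ^ (n + 1) * x = y * (y ^ n * x) := by rw [pow_succ', mul_assoc]
        _ = (y * x) * y ^ n * c ^ n := by rw [ih]; simp only [mul_assoc]
        _ = x * y * (c * y ^ n) * c ^ n := by rw [h]; simp only [mul_assoc]
        _ = x * y ^ (n + 1) * c ^ (n + 1) := by
          rw [(hy.pow_right n).eq, pow_succ' y, pow_succ' c]; simp only [mul_assoc]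
  refine ⟨key n, ?_⟩
  induction n with
  | zero => simp
  | succ n ih =>
    have hc : c ^ n.choose 2 * (x * y) = x * y * c ^ n.choose 2 :=
      ((hx.mul_right hy).pow_left _).eq
    calc (x * y) ^ (n + 1) = x ^ n * y ^ n * (c ^ n.choose 2 * (x * y)) := by
          rw [pow_succ, ih, mul_assoc]
      _ = x ^ n * (y ^ n * x) * y * c ^ n.choose 2 := by rw [hc]; simp only [mul_assoc]
      _ = x ^ (n + 1) * y ^ n * (c ^ n * y) * c ^ n.choose 2 := by
          rw [key, pow_succ x]; simp only [mul_assoc]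
      _ = x ^ (n + 1) * y ^ (n + 1) * c ^ (n + 1).choose 2 := by
          rw [(hy.pow_left n).eq, Nat.choose_succ_succ' n 1, Nat.choose_one_right, pow_add c,
            pow_succ y]
          simp only [mul_assoc]

/-- A maximal subgroup of a finite `p`-group has index `p`. -/
theorem IsPGroup.index_of_isCoatom {p : ℕ} [Fact p.Prime] {G : Type*} [Group G] [Finite G]
    (hG : IsPGroup p G) {M : Subgroup G} (hM : IsCoatom M) : M.index = p := by
  obtain ⟨m, hm⟩ := IsPGroup.iff_card.mp (hG.to_subgroup M)
  obtain ⟨k, hk⟩ := hG.index M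
  have hk0 : k ≠ 0 := by
    rintro rfl
    exact hM.1 (Subgroup.index_eq_one.mp (by simpa using hk))
  have hcard := M.card_mul_index
  rw [hm, hk, ← pow_add] at hcard
  obtain ⟨K, hK, hMK⟩ := Sylow.exists_subgroup_card_pow_succ (n := m) (H := M)
    (hcard ▸ pow_dvd_pow p (by lia)) hm
  have hp1 : 1 < p := (Fact.out : p.Prime).one_lt
  have hne : M ≠ K := by
    rintro rfl
    have := Nat.pow_right_injective hp1 (hm.symm.trans hK)
    lia
  have hKtop := hM.2 K (lt_of_le_of_ne hMK hne)
  rw [hKtop, Subgroup.card_top, ← hcard] at hK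
  have := Nat.pow_right_injective hp1 hK
  rw [hk, show k = 1 by lia, pow_one]

open scoped commutatorElement in
theorem Subgroup.commutatorElement_mem_of_index_prime {p : ℕ} [Fact p.Prime] {G : Type*} [Group G]
    {M : Subgroup G} [M.Normal] (hM : M.index = p) (x y : G) : ⁅x, y⁆ ∈ M := by
  have : IsCyclic (G ⧸ M) := isCyclic_of_prime_card (p := p) (by rw [← M.index_eq_card, hM])
  rw [← QuotientGroup.eq_one_iff, ← QuotientGroup.mk'_apply, map_commutatorElement,
    commutatorElement_eq_one_iff_mul_comm]
  exact IsMulCommutative.is_comm.comm _ _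

open scoped commutatorElement in
/-- For odd `p`, a finite `p`-group having at most `p` solutions to `x ^ p = 1` is cyclic. -/
theorem IsPGroup.isCyclic_of_card_pow_eq_one_le {p : ℕ} [Fact p.Prime] (hp2 : p ≠ 2) {G : Type*}
    [Group G] [Finite G] (hG : IsPGroup p G) (h : Nat.card {x : G // x ^ p = 1} ≤ p) :
    IsCyclic G := by
  by_contra hcyc
  have hp : p.Prime := Fact.out
  have sub_cyclic (H : Subgroup G) (hH : H ≠ ⊤) : IsCyclic H := by
    have hlt : Nat.card H < Nat.card G :=
      lt_of_le_of_ne H.card_le_card_group fun e ↦ hH (H.eq_top_of_card_eq e)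
    refine (hG.to_subgroup H).isCyclic_of_card_pow_eq_one_le hp2 (le_trans ?_ h)
    refine Nat.card_le_card_of_injective
      (fun x ↦ ⟨x.1, by simpa using congrArg Subtype.val x.2⟩) fun x y hxy ↦ ?_
    exact Subtype.ext (Subtype.ext (Subtype.mk.inj hxy))
  have : Nontrivial G := Nontrivial.of_not_isCyclic hcyc
  obtain ⟨M, hM, -⟩ := (eq_top_or_exists_le_coatom (⊥ : Subgroup G)).resolve_left bot_ne_top
  obtain ⟨g, -, hg⟩ := SetLike.exists_of_lt hM.lt_top
  obtain ⟨N, hN, hgN⟩ := (eq_top_or_exists_le_coatom (Subgroup.zpowers g)).resolve_left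
    fun e ↦ hcyc (isCyclic_iff_exists_zpowers_eq_top.mpr ⟨g, e⟩)
  have hMN : M ≠ N := fun e ↦ hg (e ▸ hgN (Subgroup.mem_zpowers g))
  have : Group.IsNilpotent G := hG.isNilpotent
  have coatom_normal {K : Subgroup G} (hK : IsCoatom K) : K.Normal :=
    Subgroup.NormalizerCondition.normal_of_coatom K
      Group.normalizerCondition_of_isNilpotent hK
  have := coatom_normal hM
  have := coatom_normal hN
  have hMi := hG.index_of_isCoatom hM
  have hNi := hG.index_of_isCoatom hN
  have pow_mem (x : G) : x ^ p ∈ M ⊓ N :=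
    ⟨by simpa [hMi] using M.pow_index_mem x, by simpa [hNi] using N.pow_index_mem x⟩
  have comm_mem (x y : G) : ⁅x, y⁆ ∈ M ⊓ N :=
    ⟨Subgroup.commutatorElement_mem_of_index_prime hMi x y,
      Subgroup.commutatorElement_mem_of_index_prime hNi x y⟩
  have central {d : G} (hd : d ∈ M ⊓ N) (x : G) : Commute d x := by
    have le_cent {K : Subgroup G} (hK : IsCoatom K) (hdK : d ∈ K) :
        K ≤ Subgroup.centralizer {d} := fun y hy ↦ by
      have := sub_cyclic K hK.1
      have e : (⟨d, hdK⟩ : K) * ⟨y, hy⟩ = ⟨y, hy⟩ * ⟨d, hdK⟩ :=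
        IsMulCommutative.is_comm.comm _ _
      exact Subgroup.mem_centralizer_singleton_iff.mpr (congrArg Subtype.val e).symm
    have htop : M ⊔ N = ⊤ := hM.2 _ (left_lt_sup.mpr fun hle ↦
      (hN.le_iff.mp hle).elim hM.1 hMN |>.elim)
    have : x ∈ Subgroup.centralizer {d} :=
      (htop ▸ sup_le (le_cent hM hd.1) (le_cent hN hd.2)) (Subgroup.mem_top x)
    exact (Subgroup.mem_centralizer_singleton_iff.mp this).symm
  have mul_pow_p (x y : G) : (x * y) ^ p = x ^ p * y ^ p := by
    have hmem := comm_mem y⁻¹ x⁻¹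
    have hc : y * x = x * y * ⁅y⁻¹, x⁻¹⁆ := by simp [commutatorElement_def, mul_assoc]
    obtain ⟨h1, h2⟩ := mul_pow_of_mul_eq_mul_mul (central hmem x) (central hmem y) hc p
    rw [(central (pow_mem y) x).eq, left_eq_mul] at h1
    obtain ⟨k, hk⟩ := hp.dvd_choose_self two_ne_zero (lt_of_le_of_ne hp.two_le hp2.symm)
    rw [h2, hk, pow_mul, h1, one_pow, mul_one]
  let φ : G →* G := { toFun := (· ^ p), map_one' := one_pow p, map_mul' := mul_pow_p }
  have hker : Nat.card φ.ker ≤ p := h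
  have hrange : Nat.card φ.range ≤ Nat.card ↥(M ⊓ N) :=
    Subgroup.card_le_of_le (by rintro _ ⟨x, rfl⟩; exact pow_mem x)
  have hcard := φ.ker.card_mul_index
  rw [Subgroup.index_ker, ← (M ⊓ N).card_mul_index] at hcard
  have hindex : p < (M ⊓ N).index := hMi ▸ Subgroup.index_strictAnti
    (inf_lt_left.mpr fun hle ↦ (hM.le_iff.mp hle).elim hN.1 fun e ↦ hMN e.symm)
  have hpos : 0 < Nat.card ↥(M ⊓ N) := Nat.card_pos
  nlinarith [Nat.mul_le_mul hker hrange]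
termination_by Nat.card G

/-- If the elements of order `p` act without nonzero fixed points on an `𝔽_q`-module, where `q ≠ p`,
then commuting elements of order `p` generate the same subgroup. -/
theorem Representation.mem_zpowers_of_fixedPointFree {p q : ℕ} (hp : p.Prime) (hq : q.Prime)
    (hpq : p ≠ q) {G V : Type*} [Group G] [AddCommGroup V] [Module (ZMod q) V] [Nontrivial V]
    (ρ : Representation (ZMod q) G V)
    (hfix : ∀ s : G, s ≠ 1 → s ^ p = 1 → ∀ v : V, ρ s v = v → v = 0)
    {a b : G} (hab : Commute a b) (ha : a ^ p = 1) (hb : b ^ p = 1) (hb1 : b ≠ 1) :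
    a ∈ Subgroup.zpowers b := by
  by_contra hmem
  have norm_eq_zero (s : G) (hs1 : s ≠ 1) (hs : s ^ p = 1) (v : V) :
      ∑ i ∈ Finset.range p, ρ (s ^ i) v = 0 := by
    refine hfix s hs1 hs _ ?_
    have e := Finset.sum_range_succ' (fun i ↦ ρ (s ^ i) v) p
    rw [Finset.sum_range_succ, hs, pow_zero, add_left_inj] at e
    simp_rw [map_sum, ← Module.End.mul_apply, ← map_mul, ← pow_succ', ← e]
  have : Fact p.Prime := ⟨hp⟩
  have : Fact q.Prime := ⟨hq⟩
  obtain ⟨v, hv⟩ := exists_ne (0 : V)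
  have hline (j : ℕ) : ∑ i ∈ Finset.range p, ρ ((a * b ^ j) ^ i) v = 0 := by
    refine norm_eq_zero _ (fun e ↦ hmem ?_) ?_ v
    · rw [eq_inv_of_mul_eq_one_left e]
      exact inv_mem (Subgroup.npow_mem_zpowers b j)
    · rw [(hab.pow_right j).mul_pow, ha, ← pow_mul, mul_comm j, pow_mul, hb, one_pow, one_mul]
  have hsum : ∑ j ∈ Finset.range p, ∑ i ∈ Finset.range p, ρ ((a * b ^ j) ^ i) v = 0 :=
    Finset.sum_eq_zero fun j _ ↦ hline j
  rw [Finset.sum_comm, Finset.sum_eq_single_of_mem 0 (Finset.mem_range.mpr hp.pos)] at hsum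
  · have hpv : (p : ZMod q) • v = 0 := by simpa [Nat.cast_smul_eq_nsmul] using hsum
    refine (smul_eq_zero.mp hpv).elim (fun h0 ↦ ?_) hv
    exact hpq ((Nat.prime_dvd_prime_iff_eq hq hp).mp ((ZMod.natCast_eq_zero_iff p q).mp h0)).symm
  · intro i hi hi0
    have hbi : b ^ i ≠ 1 := fun e ↦ by
      have := Nat.le_of_dvd (Nat.pos_of_ne_zero hi0)
        (orderOf_eq_prime hb hb1 ▸ orderOf_dvd_of_pow_eq_one e)
      exact absurd (Finset.mem_range.mp hi) this.not_gt
    have hpow (j : ℕ) : (a * b ^ j) ^ i = a ^ i * (b ^ i) ^ j := by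
      rw [(hab.pow_right j).mul_pow, ← pow_mul, ← pow_mul, mul_comm j]
    simp_rw [hpow, map_mul, Module.End.mul_apply, ← map_sum]
    rw [norm_eq_zero _ hbi (by rw [← pow_mul, mul_comm, pow_mul, hb, one_pow]), map_zero]

/-- Let `p ≠ q` be primes and let a finite group with trivial center act faithfully on a nonzero
`𝔽_q`-module such that elements of order `p` act without nonzero fixed points. Then the Sylow
`p`-subgroups are cyclic. -/
theorem Representation.isCyclic_sylow_of_fixedPointFree {p q : ℕ} (hp : p.Prime) (hq : q.Prime)
    (hpq : p ≠ q) {G V : Type*} [Group G] [Finite G] (hG : Subgroup.center G = ⊥)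
    [AddCommGroup V] [Module (ZMod q) V] [Nontrivial V] (ρ : Representation (ZMod q) G V)
    (hρ : ∀ s : G, (∀ v : V, ρ s v = v) → s = 1)
    (hfix : ∀ s : G, s ≠ 1 → s ^ p = 1 → ∀ v : V, ρ s v = v → v = 0) (T : Sylow p G) :
    IsCyclic T := by
  have : Fact p.Prime := ⟨hp⟩
  cases subsingleton_or_nontrivial T
  · infer_instance
  have := T.2.center_nontrivial
  obtain ⟨z, hz⟩ := exists_prime_orderOf_dvd_card' (G := Subgroup.center T) p
    ((T.2.to_subgroup _).card_eq_or_dvd.resolve_left Finite.one_lt_card.ne')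
  obtain ⟨hzp, hz1⟩ := orderOf_eq_prime_iff.mp hz
  have hzp' : (z : G) ^ p = 1 := by
    exact_mod_cast congrArg (fun x : Subgroup.center T ↦ (x : G)) hzp
  have hz1' : (z : G) ≠ 1 := by simpa using hz1
  by_cases hp2 : p = 2
  · -- an involution acts as `-1`, hence is central
    subst hp2
    have neg (v : V) : ρ z v = -v := by
      refine eq_neg_of_add_eq_zero_left (hfix z hz1' hzp' _ ?_)
      rw [map_add, ← Module.End.mul_apply, ← map_mul, ← pow_two, hzp', map_one,
        Module.End.one_apply, add_comm]
    refine absurd ?_ hz1'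
    rw [← Subgroup.mem_bot, ← hG, Subgroup.mem_center_iff]
    intro g
    rw [← mul_inv_eq_one]
    refine hρ _ fun v ↦ ?_
    rw [show g * (z : G) * ((z : G) * g)⁻¹ = g * (z * (g⁻¹ * (z : G)⁻¹)) by group,
      show (z : G)⁻¹ = z from inv_eq_of_mul_eq_one_left (pow_two (z : G) ▸ hzp')]
    simp [map_mul, neg]
  refine T.2.isCyclic_of_card_pow_eq_one_le hp2 ?_
  have hmem (x : {x : T // x ^ p = 1}) : (x : G) ∈ Subgroup.zpowers (z : G) :=
    Representation.mem_zpowers_of_fixedPointFree hp hq hpq ρ hfix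
      (congrArg Subtype.val (Subgroup.mem_center_iff.mp z.2 x.1))
      (by exact_mod_cast congrArg (fun x : T ↦ (x : G)) x.2) hzp' hz1'
  have hcard : Nat.card (Subgroup.zpowers (z : G)) = p := by
    rw [Nat.card_zpowers, orderOf_eq_prime_iff.mpr ⟨hzp', hz1'⟩]
  refine (Nat.card_le_card_of_injective (fun x ↦ (⟨x.1, hmem x⟩ : Subgroup.zpowers (z : G)))
    fun x y hxy ↦ ?_).trans_eq hcard
  exact Subtype.ext (Subtype.ext (Subtype.mk.inj hxy))

/-- Let `p, q` be distinct primes and `S` a finite nonabelian simple group admitting a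
`(p,q)`-Frattini triple.  Then the Sylow `p`-subgroups and the Sylow `q`-subgroups of
`S` are cyclic. -/
theorem frattini_triple_sylow_cyclic
    (S : Type) [Group S] [Finite S] (p q : ℕ)
    (hp : p.Prime) (hq : q.Prime) (hpq : p ≠ q)
    (hsimple : IsSimpleGroup S) (hnonab : ¬ ∀ a b : S, a * b = b * a)
    (ht : AdmitsFrattiniTriple p q S) :
    (∀ T : Sylow p S, IsCyclic T) ∧ ∀ T : Sylow q S, IsCyclic T := by
  obtain ⟨t⟩ := ht
  let := t.addP
  let := t.modP
  let := t.addQ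
  let := t.modQ
  have := t.nontrivP
  have := t.nontrivQ
  have hcenter : Subgroup.center S = ⊥ :=
    (Subgroup.Normal.eq_bot_or_eq_top inferInstance).resolve_right fun h ↦ hnonab fun a b ↦
      (Subgroup.mem_center_iff.mp (h ▸ Subgroup.mem_top b : b ∈ Subgroup.center S) a)
  have : Fact p.Prime := ⟨hp⟩
  have : Fact q.Prime := ⟨hq⟩
  exact ⟨t.ρQ.isCyclic_sylow_of_fixedPointFree hp hq hpq hcenter t.faithfulQ fun s h1 hs ↦
      t.fixQ s h1 ⟨1, by rw [pow_one, orderOf_eq_prime hs h1]⟩,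
    t.ρP.isCyclic_sylow_of_fixedPointFree hq hp hpq.symm hcenter t.faithfulP fun s h1 hs ↦
      t.fixP s h1 ⟨1, by rw [pow_one, orderOf_eq_prime hs h1]⟩⟩
end

section
/- Let p and q be distinct primes and let G be a finite group such that Frat(G) = P × Q is an internal direct product, where P is the Sylow p-subgroup and Q is the Sylow q-subgroup of Frat(G), and such that P and Q are the unique minimal normal subgroups of G. If every element of G of order divisible by p·q and by no other prime lies in Frat(G) (i.e., Ω**_{p,q}(G) = ∅), then every element of G of q-power order that centralizes P lies in Q; consequently C_G(P) has Q as a normal Sylow q-subgroup. -/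
/-- `N` is a minimal normal subgroup of `G`. -/
def IsMinimalNormal {G : Type*} [Group G] (N : Subgroup G) : Prop :=
  N.Normal ∧ N ≠ ⊥ ∧ ∀ M : Subgroup G, M.Normal → M ≤ N → M = ⊥ ∨ M = N

/-- If a normal `p`-subgroup `P` and a normal `q`-subgroup `Q` with `p ≠ q` primes intersect
trivially, then every element of `q`-power order in `P ⊔ Q` lies in `Q`. -/
theorem mem_right_of_mem_sup_of_orderOf_eq_pow {G : Type*} [Group G] {p q : ℕ}
    (hp : p.Prime) (hq : q.Prime) (hpq : p ≠ q) {P Q : Subgroup G} [P.Normal] [Q.Normal]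
    (hP : IsPGroup p P) (hQ : IsPGroup q Q) (hdisj : Disjoint P Q) {y : G} {b : ℕ}
    (hy : orderOf y = q ^ b) (hmem : y ∈ P ⊔ Q) : y ∈ Q := by
  obtain ⟨u, hu, v, hv, rfl⟩ := Subgroup.mem_sup_of_normal_right.mp hmem
  have hcomm : Commute u v :=
    Subgroup.commute_of_normal_of_disjoint P Q inferInstance inferInstance hdisj u v hu hv
  obtain ⟨k, hk⟩ := hP ⟨u, hu⟩
  obtain ⟨l, hl⟩ := hQ ⟨v, hv⟩
  have huk : u ^ p ^ k = 1 := by simpa using congrArg Subtype.val hk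
  have hvl : v ^ q ^ l = 1 := by simpa using congrArg Subtype.val hl
  have huq : u ^ q ^ (b + l) = 1 := by
    have hpow : (u * v) ^ q ^ (b + l) = 1 := by
      rw [pow_add, pow_mul, ← hy, pow_orderOf_eq_one, one_pow]
    have hvpow : v ^ q ^ (b + l) = 1 := by
      rw [add_comm, pow_add, pow_mul, hvl, one_pow]
    rwa [hcomm.mul_pow, hvpow, mul_one] at hpow
  have hcop : Nat.Coprime (p ^ k) (q ^ (b + l)) :=
    Nat.Coprime.pow _ _ ((Nat.coprime_primes hp hq).mpr hpq)
  have hu1 : u = 1 := orderOf_eq_one_iff.mp <|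
    Nat.eq_one_of_dvd_coprimes hcop (orderOf_dvd_of_pow_eq_one huk)
      (orderOf_dvd_of_pow_eq_one huq)
  simpa [hu1] using hv

/-- Let `p ≠ q` be primes and `G` a finite group with `Frat(G) = P × Q`, where `P` and
`Q` are the Sylow `p`- and `q`-subgroups of `Frat(G)` and are the unique minimal normal
subgroups of `G`.  If `Ω**_{p,q}(G) = ∅` (every element of `G` whose order is divisible
by `p·q` and by no other prime lies in `Frat(G)`), then every element of `G` of
`q`-power order centralizing `P` lies in `Q`; consequently `Q` is a normal Sylow
`q`-subgroup of `C_G(P)`. -/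
theorem q_elements_of_centralizer_mem
    (G : Type*) [Group G] [Finite G] (p q : ℕ)
    (hp : p.Prime) (hq : q.Prime) (hpq : p ≠ q)
    (P Q : Subgroup G) (hPp : IsPGroup p P) (hQq : IsPGroup q Q)
    (hsup : P ⊔ Q = frattini G) (hinf : P ⊓ Q = ⊥)
    (hPmin : IsMinimalNormal P) (hQmin : IsMinimalNormal Q)
    (huniq : ∀ N : Subgroup G, IsMinimalNormal N → N = P ∨ N = Q)
    (homega : ∀ g : G,
      (p * q ∣ orderOf g ∧ ∀ r : ℕ, r.Prime → r ∣ orderOf g → r = p ∨ r = q) →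
      g ∈ frattini G) :
    (∀ y : G, (∃ b : ℕ, orderOf y = q ^ b) →
        y ∈ Subgroup.centralizer (P : Set G) → y ∈ Q) ∧
      Q ≤ Subgroup.centralizer (P : Set G) ∧
      (Q.subgroupOf (Subgroup.centralizer (P : Set G))).Normal ∧
      ∀ y : ↥(Subgroup.centralizer (P : Set G)), (∃ b : ℕ, orderOf y = q ^ b) →
        y ∈ Q.subgroupOf (Subgroup.centralizer (P : Set G)) := by
  have hPn : P.Normal := hPmin.1
  have hQn : Q.Normal := hQmin.1
  have hdisj : Disjoint P Q := disjoint_iff.mpr hinf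
  have hmem : ∀ y : G, (∃ b : ℕ, orderOf y = q ^ b) →
      y ∈ Subgroup.centralizer (P : Set G) → y ∈ Q := by
    rintro y ⟨b, hb⟩ hy
    rcases Nat.eq_zero_or_pos b with rfl | hbpos
    · rw [pow_zero, orderOf_eq_one_iff] at hb
      exact hb ▸ Q.one_mem
    obtain ⟨x, hxP, hx1⟩ := P.bot_or_exists_ne_one.resolve_left hPmin.2.1
    obtain ⟨a, ha⟩ : ∃ a : ℕ, orderOf x = p ^ a := by
      have : Fact p.Prime := ⟨hp⟩
      obtain ⟨a, ha⟩ := IsPGroup.iff_orderOf.mp hPp ⟨x, hxP⟩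
      exact ⟨a, by simpa using ha⟩
    have ha0 : a ≠ 0 := by
      rintro rfl
      exact hx1 (orderOf_eq_one_iff.mp (by simpa using ha))
    have hcomm : Commute x y := Subgroup.mem_centralizer_iff.mp hy x hxP
    have hord : orderOf (x * y) = p ^ a * q ^ b := by
      rw [hcomm.orderOf_mul_eq_mul_orderOf_of_coprime, ha, hb]
      rw [ha, hb]
      exact Nat.Coprime.pow _ _ ((Nat.coprime_primes hp hq).mpr hpq)
    have hxy : x * y ∈ P ⊔ Q := by
      rw [hsup]
      refine homega _ ⟨?_, fun r hr hdvd => ?_⟩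
      · rw [hord]
        exact mul_dvd_mul (dvd_pow_self p ha0) (dvd_pow_self q hbpos.ne')
      · rw [hord] at hdvd
        exact (hr.dvd_mul.mp hdvd).imp
          (fun h => (Nat.prime_dvd_prime_iff_eq hr hp).mp (hr.dvd_of_dvd_pow h))
          (fun h => (Nat.prime_dvd_prime_iff_eq hr hq).mp (hr.dvd_of_dvd_pow h))
    exact mem_right_of_mem_sup_of_orderOf_eq_pow hp hq hpq hPp hQq hdisj hb
      ((Subgroup.mul_mem_cancel_left _ (Subgroup.mem_sup_left hxP)).mp hxy)
  refine ⟨hmem, fun v hv => Subgroup.mem_centralizer_iff.mpr fun u hu =>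
    Subgroup.commute_of_normal_of_disjoint P Q hPn hQn hdisj u v hu hv, inferInstance, ?_⟩
  rintro y ⟨b, hb⟩
  exact Subgroup.mem_subgroupOf.mpr (hmem y ⟨b, by rwa [Subgroup.orderOf_coe]⟩ y.2)
end
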